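/- arXiv:2510.17485 — 2 statements merged into one kernel-verified Lean document; each statement's English description precedes it below -/
import Mathlib

section
/- Let n ∈ ℕ and let γ_i > 0 for 1 ≤ i ≤ n. Then the family ((1 + i·k_1^{γ_1},…,1 + i·k_n^{γ_n})) indexed by (k_1,…,k_n) ∈ ℕ^n (where i is the imaginary unit) is a uniqueness sequence for the n-dimensional Laplace transform if and only if γ_i ≤ 1/2 for all i = 1,…,n. -/
open MeasureTheory Filter Set

noncomputable section

/-- Partial Laplace integral of `f : [0,∞) → ℂ` at `l` up to time `t`. -/
def lapPartial (f : ℝ → ℂ) (l : ℂ) (t : ℝ) : ℂ :=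
  ∫ s in Set.Ioc (0:ℝ) t, Complex.exp (-(l * s)) * f s

/-- The Laplace transform of `f` at `l` exists and equals `F`. -/
def HasLaplace (f : ℝ → ℂ) (l : ℂ) (F : ℂ) : Prop :=
  Filter.Tendsto (lapPartial f l) Filter.atTop (nhds F)

/-- The abscissa of convergence of the Laplace transform of `f`, as an extended real. -/
def laplaceAbs (f : ℝ → ℂ) : EReal :=
  sInf {x : EReal | ∃ ω : ℝ, x = (ω : EReal) ∧ ∀ l : ℂ, ω < l.re → ∃ F, HasLaplace f l F}

/-- `lam` is a uniqueness sequence for the one-dimensional Laplace transform. -/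
def IsUniquenessSeq (lam : ℕ → ℂ) : Prop :=
  ∀ f : ℝ → ℂ, MeasureTheory.LocallyIntegrableOn f (Set.Ici 0) →
    (∀ k, laplaceAbs f < (((lam k).re : ℝ) : EReal)) →
    (∀ k, HasLaplace f (lam k) 0) →
    ∀ᵐ t : ℝ, 0 ≤ t → f t = 0

/-- Partial `n`-dimensional Laplace integral of `f : [0,∞)^n → ℂ` at `l` over the box `[0,t]`. -/
def mLapPartial (n : ℕ) (f : (Fin n → ℝ) → ℂ) (l : Fin n → ℂ) (t : Fin n → ℝ) : ℂ :=
  ∫ s in Set.pi Set.univ (fun i => Set.Ioc (0:ℝ) (t i)),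
    Complex.exp (-(∑ i, l i * (s i))) * f s

/-- The `n`-dimensional Laplace transform of `f` at `l` exists (as the iterated limit
`t₁ → ∞, …, tₙ → ∞` of the partial integrals) and equals `F`. -/
def HasMLaplace (n : ℕ) (f : (Fin n → ℝ) → ℂ) (l : Fin n → ℂ) (F : ℂ) : Prop :=
  Filter.Tendsto (mLapPartial n f l) Filter.atTop (nhds F)

/-- `Ω(f)`: the region of convergence of the `n`-dimensional Laplace integral. -/
def mOmega (n : ℕ) (f : (Fin n → ℝ) → ℂ) : Set (Fin n → ℂ) :=
  {l | ∃ F, HasMLaplace n f l F}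

/-- `Ω_b(f)`: the set of `l` for which the partial Laplace integrals are bounded. -/
def mOmegaB (n : ℕ) (f : (Fin n → ℝ) → ℂ) : Set (Fin n → ℂ) :=
  {l | Bornology.IsBounded (mLapPartial n f l '' {t | ∀ i, 0 ≤ t i})}

/-- A countable family `lam : K → ℂⁿ` is a uniqueness sequence for the `n`-dimensional
Laplace transform. -/
def IsMUniquenessFamily (n : ℕ) {K : Type} [Countable K] (lam : K → Fin n → ℂ) : Prop :=
  ∀ f : (Fin n → ℝ) → ℂ,
    MeasureTheory.LocallyIntegrableOn f {t | ∀ i, 0 ≤ t i} →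
    (∃ ω : Fin n → EReal, (∀ j, ω j ≠ ⊤) ∧
      {l : Fin n → ℂ | ∀ j, ω j < (((l j).re : ℝ) : EReal)} ⊆ mOmegaB n f ∩ mOmega n f ∧
      ∀ k j, ω j < ((((lam k j).re : ℝ)) : EReal)) →
    (∀ k, HasMLaplace n f (lam k) 0) →
    ∀ᵐ t : Fin n → ℝ, (∀ i, 0 ≤ t i) → f t = 0

/-- Fubini for a primitive: the integral over `u` of `ψ u` times the integral of `g` over
`{s | s ≤ u}` equals the integral over `s` of `g s` times the integral of `ψ` over `{u | s ≤ u}`. -/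
lemma integral_mul_integral_Iic_indicator {α : Type*} [MeasurableSpace α] [PartialOrder α]
    [TopologicalSpace α] [OrderClosedTopology α] [SecondCountableTopology α]
    [OpensMeasurableSpace α] {ν : Measure α} [SFinite ν] {g ψ : α → ℂ}
    (hg : Integrable g ν) (hψ : Integrable ψ ν) :
    ∫ u, ψ u * ∫ s, (Iic u).indicator g s ∂ν ∂ν =
      ∫ s, g s * ∫ u, (Ici s).indicator ψ u ∂ν ∂ν := by
  have hinteg : Integrable (Function.uncurry fun u s => ψ u * (Iic u).indicator g s)
      (ν.prod ν) := by
    have hm : MeasurableSet {p : α × α | p.2 ≤ p.1} :=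
      measurableSet_le measurable_snd measurable_fst
    refine ((hψ.mul_prod hg).indicator hm).congr (Eventually.of_forall fun p => ?_)
    by_cases hp : p.2 ≤ p.1 <;> simp [Function.uncurry, indicator, hp]
  calc _ = ∫ u, ∫ s, ψ u * (Iic u).indicator g s ∂ν ∂ν := by
        simp_rw [integral_const_mul]
    _ = ∫ s, ∫ u, ψ u * (Iic u).indicator g s ∂ν ∂ν := integral_integral_swap hinteg
    _ = ∫ s, ∫ u, g s * (Ici s).indicator ψ u ∂ν ∂ν := by
        congr! 4 with s u
        by_cases hsu : s ≤ u <;> simp [indicator, hsu, mul_comm]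
    _ = _ := by simp_rw [integral_const_mul]

/-- A family of functions separates the integrable functions for `ν`. -/
def Separates {α K : Type*} [MeasurableSpace α] (ν : Measure α) (e : K → α → ℂ) : Prop :=
  ∀ h : α → ℂ, Integrable h ν → (∀ k, ∫ x, e k x * h x ∂ν = 0) → h =ᵐ[ν] 0

lemma Separates.prod {α β K L : Type*} [MeasurableSpace α] [MeasurableSpace β] [Countable L]
    {ν : Measure α} {ρ : Measure β} [SFinite ν] [SFinite ρ] {e : K → α → ℂ} {d : L → β → ℂ}
    (he : Separates ν e) (hd : Separates ρ d) (hem : ∀ k, Measurable (e k))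
    (hdm : ∀ l, Measurable (d l)) (heb : ∀ k, ∃ C, ∀ x, ‖e k x‖ ≤ C)
    (hdb : ∀ l, ∃ C, ∀ x, ‖d l x‖ ≤ C) :
    Separates (ν.prod ρ) (fun (p : K × L) (x : α × β) => e p.1 x.1 * d p.2 x.2) := by
  intro h hh hz
  have hinteg : ∀ l, Integrable (fun x : α × β => d l x.2 * h x) (ν.prod ρ) := fun l => by
    obtain ⟨C, hC⟩ := hdb l
    exact hh.bdd_mul ((hdm l).comp measurable_snd).aestronglyMeasurable
      (Eventually.of_forall fun x => hC x.2)
  have hslice : ∀ l, (fun x => ∫ y, d l y * h (x, y) ∂ρ) =ᵐ[ν] 0 := fun l => by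
    refine he _ (hinteg l).integral_prod_left fun k => ?_
    obtain ⟨C, hC⟩ := heb k
    have hk : Integrable (fun x : α × β => e k x.1 * (d l x.2 * h x)) (ν.prod ρ) :=
      (hinteg l).bdd_mul ((hem k).comp measurable_fst).aestronglyMeasurable
        (Eventually.of_forall fun x => hC x.1)
    have := hz (k, l)
    simp only [mul_assoc] at this
    rw [integral_prod _ hk] at this
    simpa only [integral_const_mul] using this
  have hae : ∀ᵐ x ∂ν, ∀ᵐ y ∂ρ, h (x, y) = 0 := by
    filter_upwards [ae_all_iff.2 hslice, hh.prod_right_ae] with x hx hi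
    exact hd _ hi hx
  have hn : ∫⁻ z, ‖h z‖ₑ ∂(ν.prod ρ) = 0 := by
    rw [lintegral_prod _ hh.aestronglyMeasurable.enorm]
    refine lintegral_eq_zero_of_ae_eq_zero ?_
    filter_upwards [hae] with x hx
    refine lintegral_eq_zero_of_ae_eq_zero ?_
    filter_upwards [hx] with y hy
    simp [hy]
  rw [lintegral_eq_zero_iff' hh.aestronglyMeasurable.enorm] at hn
  filter_upwards [hn] with z hz
  simpa using hz

/-- Tensor products of separating families separate. -/
lemma Separates.pi {K : Type*} [Countable K] {n : ℕ} {ν : Fin n → Measure ℝ}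
    [∀ i, SigmaFinite (ν i)] {e : Fin n → K → ℝ → ℂ} (he : ∀ i, Separates (ν i) (e i))
    (hem : ∀ i k, Measurable (e i k)) (heb : ∀ i k, ∃ C, ∀ x, ‖e i k x‖ ≤ C) :
    Separates (Measure.pi ν) (fun (k : Fin n → K) x => ∏ i, e i (k i) (x i)) := by
  induction n with
  | zero =>
    intro h _ hz
    have := hz Fin.elim0
    rw [Measure.pi_of_empty, integral_dirac] at this
    rw [Measure.pi_of_empty]
    simpa [ae_dirac_eq, EventuallyEq] using this
  | succ n ih =>
    intro h hh hz
    have hmp := measurePreserving_piFinSuccAbove ν 0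
    set φ := MeasurableEquiv.piFinSuccAbove (fun _ : Fin (n + 1) => ℝ) 0 with hφ
    have hprod := (he 0).prod (ih (ν := fun j => ν (Fin.succAbove 0 j))
      (e := fun j => e (Fin.succAbove 0 j)) (fun i => he _) (fun i => hem _) fun i => heb _)
      (hem 0) (fun l => by have := fun i => hem (Fin.succAbove 0 i); fun_prop) (heb 0) (fun l => by
        choose C hC using fun i => heb (Fin.succAbove 0 i) (l i)
        refine ⟨∏ i, C i, fun x => ?_⟩
        rw [norm_prod]
        exact Finset.prod_le_prod (fun _ _ => norm_nonneg _) fun i _ => hC i (x i))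
    have key := hprod (h ∘ φ.symm) ?_ ?_
    · have h2 := hmp.quasiMeasurePreserving.ae_eq_comp key
      filter_upwards [h2] with x hx
      simpa using hx
    · rw [← hmp.integrable_comp_emb φ.measurableEmbedding]
      simpa [Function.comp_def] using hh
    · rintro ⟨k, l⟩
      rw [← hmp.integral_comp φ.measurableEmbedding]
      have := hz (Fin.cons k l)
      rw [← this]
      congr 1 with x
      simp only [Function.comp, MeasurableEquiv.symm_apply_apply]
      rw [Fin.prod_univ_succAbove _ 0]
      simp [hφ, MeasurableEquiv.piFinSuccAbove, Fin.insertNthEquiv, Fin.tail]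

/-- The Laplace integral of `h` over `(0, ∞)`. -/
def laplaceIoi (h : ℝ → ℂ) (μ : ℂ) : ℂ := ∫ t in Ioi (0 : ℝ), Complex.exp (-(μ * t)) * h t

/-- Continuous functions that decay like `exp (-ε t)` on `[0, ∞)`. -/
structure ExpDecay (ε : ℝ) (h : ℝ → ℂ) : Prop where
  continuous : Continuous h
  bound : ∃ C, ∀ t, 0 ≤ t → ‖h t‖ ≤ C * Real.exp (-ε * t)

lemma norm_exp_neg_mul_ofReal (μ : ℂ) (t : ℝ) :
    ‖Complex.exp (-(μ * t))‖ = Real.exp (-μ.re * t) := by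
  rw [Complex.norm_exp]; simp

namespace ExpDecay

variable {ε : ℝ} {h w : ℝ → ℂ}

lemma add (hh : ExpDecay ε h) (hw : ExpDecay ε w) : ExpDecay ε (fun t => h t + w t) := by
  obtain ⟨C, hC⟩ := hh.bound
  obtain ⟨D, hD⟩ := hw.bound
  refine ⟨hh.continuous.add hw.continuous, C + D, fun t ht => ?_⟩
  rw [add_mul]
  exact (norm_add_le _ _).trans (add_le_add (hC t ht) (hD t ht))

lemma const_mul (hh : ExpDecay ε h) (c : ℂ) : ExpDecay ε (fun t => c * h t) := by
  obtain ⟨C, hC⟩ := hh.bound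
  refine ⟨hh.continuous.const_mul c, ‖c‖ * C, fun t ht => ?_⟩
  rw [norm_mul, mul_assoc]
  exact mul_le_mul_of_nonneg_left (hC t ht) (norm_nonneg _)

lemma exp_mul (hh : ExpDecay ε h) {μ : ℂ} (hμ : 0 ≤ μ.re) :
    ExpDecay ε (fun t => Complex.exp (-(μ * t)) * h t) := by
  obtain ⟨C, hC⟩ := hh.bound
  refine ⟨by have := hh.continuous; fun_prop, C, fun t ht => ?_⟩
  rw [norm_mul, norm_exp_neg_mul_ofReal]
  have : Real.exp (-μ.re * t) ≤ 1 := Real.exp_le_one_iff.2 (by nlinarith)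
  nlinarith [hC t ht, norm_nonneg (h t), Real.exp_pos (-μ.re * t)]

lemma integrableOn (hh : ExpDecay ε h) (hε : 0 < ε) : IntegrableOn h (Ioi 0) := by
  obtain ⟨C, hC⟩ := hh.bound
  refine Integrable.mono' ((integrableOn_exp_mul_Ioi (neg_lt_zero.2 hε) 0).const_mul C)
    hh.continuous.aestronglyMeasurable ?_
  filter_upwards [ae_restrict_mem measurableSet_Ioi] with t ht using hC t (le_of_lt ht)

lemma tendsto_zero (hh : ExpDecay ε h) (hε : 0 < ε) : Tendsto h atTop (nhds 0) := by
  obtain ⟨C, hC⟩ := hh.bound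
  have h0 : Tendsto (fun t : ℝ => C * Real.exp (-ε * t)) atTop (nhds 0) := by
    have : Tendsto (fun t : ℝ => -ε * t) atTop atBot :=
      tendsto_id.const_mul_atTop_of_neg (neg_lt_zero.2 hε)
    simpa using (Real.tendsto_exp_atBot.comp this).const_mul C
  exact squeeze_zero_norm' ((eventually_ge_atTop 0).mono hC) h0

lemma integrableOn_norm_sq (hh : ExpDecay ε h) (hε : 0 < ε) :
    IntegrableOn (fun t => ‖h t‖ ^ 2) (Ioi 0) := by
  obtain ⟨C, hC⟩ := hh.bound
  refine Integrable.mono' ((integrableOn_exp_mul_Ioi (neg_lt_zero.2 hε) 0).const_mul (C ^ 2))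
    (hh.continuous.norm.pow 2).aestronglyMeasurable ?_
  filter_upwards [ae_restrict_mem measurableSet_Ioi] with t ht
  have h1 : Real.exp (-ε * t) ≤ 1 := Real.exp_le_one_iff.2 (by nlinarith [mem_Ioi.1 ht])
  have h2 := hC t (le_of_lt ht)
  have h3 := Real.exp_pos (-ε * t)
  rw [Real.norm_of_nonneg (by positivity)]
  calc ‖h t‖ ^ 2 ≤ (C * Real.exp (-ε * t)) ^ 2 := by gcongr
    _ = C ^ 2 * (Real.exp (-ε * t) * Real.exp (-ε * t)) := by ring
    _ ≤ C ^ 2 * (Real.exp (-ε * t) * 1) := by gcongr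
    _ = _ := by ring

lemma laplaceIoi_add (hh : ExpDecay ε h) (hw : ExpDecay ε w) (hε : 0 < ε) {μ : ℂ}
    (hμ : 0 ≤ μ.re) :
    laplaceIoi (fun t => h t + w t) μ = laplaceIoi h μ + laplaceIoi w μ := by
  simp only [laplaceIoi, mul_add]
  exact integral_add ((hh.exp_mul hμ).integrableOn hε) ((hw.exp_mul hμ).integrableOn hε)

lemma _root_.laplaceIoi_const_mul (c : ℂ) (h : ℝ → ℂ) (μ : ℂ) :
    laplaceIoi (fun t => c * h t) μ = c * laplaceIoi h μ := by
  simp only [laplaceIoi, mul_left_comm _ c, integral_const_mul]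

/-- The Laplace transform of a solution of `w' = h + b w`, `w 0 = 0`. -/
lemma laplaceIoi_of_hasDerivAt (hh : ExpDecay ε h) (hw : ExpDecay ε w) (hε : 0 < ε) {b : ℂ}
    (hd : ∀ t, HasDerivAt w (h t + b * w t) t) (h0 : w 0 = 0) {μ : ℂ} (hμ : 0 ≤ μ.re) :
    (μ - b) * laplaceIoi w μ = laplaceIoi h μ := by
  have hE := hh.add (hw.const_mul (b - μ))
  have hder : ∀ t : ℝ, HasDerivAt (fun t : ℝ => Complex.exp (-(μ * t)) * w t)
      (Complex.exp (-(μ * t)) * (h t + (b - μ) * w t)) t := fun t => by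
    have h1 : HasDerivAt (fun t : ℝ => -(μ * t)) (-(μ * 1)) t :=
      ((Complex.ofRealCLM.hasDerivAt (x := t)).const_mul μ).neg
    refine (h1.cexp.mul (hd t)).congr_deriv ?_
    ring
  have := integral_Ioi_of_hasDerivAt_of_tendsto (a := 0) (hder 0).continuousAt.continuousWithinAt
    (fun t _ => hder t) ((hE.exp_mul hμ).integrableOn hε) ((hw.exp_mul hμ).tendsto_zero hε)
  change laplaceIoi (fun t => h t + (b - μ) * w t) μ = _ at this
  rw [hh.laplaceIoi_add (hw.const_mul _) hε hμ, laplaceIoi_const_mul, h0] at this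
  linear_combination -this

/-- The map `h ↦ h + 2 Re b · w`, where `w' = h + b w` and `w 0 = 0`, preserves the `L²` norm. -/
lemma integral_norm_sq_eq (hh : ExpDecay ε h) (hw : ExpDecay ε w) (hε : 0 < ε) {b : ℂ}
    (hd : ∀ t, HasDerivAt w (h t + b * w t) t) (h0 : w 0 = 0) :
    ∫ t in Ioi (0 : ℝ), ‖h t + ((2 * b.re : ℝ) : ℂ) * w t‖ ^ 2 =
      ∫ t in Ioi (0 : ℝ), ‖h t‖ ^ 2 := by
  have hg := hh.add (hw.const_mul ((2 * b.re : ℝ) : ℂ))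
  have hder : ∀ t : ℝ, HasDerivAt (fun t => 2 * b.re * ‖w t‖ ^ 2)
      (‖h t + ((2 * b.re : ℝ) : ℂ) * w t‖ ^ 2 - ‖h t‖ ^ 2) t := fun t => by
    refine ((hd t).norm_sq.const_mul (2 * b.re)).congr_deriv ?_
    simp only [Complex.inner, Complex.sq_norm, Complex.normSq_apply]
    simp
    ring
  have hlim : Tendsto (fun t => 2 * b.re * ‖w t‖ ^ 2) atTop (nhds 0) := by
    simpa using ((hw.tendsto_zero hε).norm.pow 2).const_mul (2 * b.re)
  have := integral_Ioi_of_hasDerivAt_of_tendsto (a := 0) (hder 0).continuousAt.continuousWithinAt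
    (fun t _ => hder t) ((hg.integrableOn_norm_sq hε).sub (hh.integrableOn_norm_sq hε)) hlim
  rw [integral_sub (hg.integrableOn_norm_sq hε) (hh.integrableOn_norm_sq hε), h0] at this
  simp only [norm_zero] at this
  linarith

/-- Decaying solutions of `w' = h + b w`, `w 0 = 0`. -/
lemma exists_hasDerivAt (hh : ExpDecay ε h) (hε : 0 < ε) {b : ℂ}
    (hb : b.re < -ε ∨ 0 < b.re ∧ laplaceIoi h b = 0) :
    ∃ w, ExpDecay ε w ∧ (∀ t, HasDerivAt w (h t + b * w t) t) ∧ w 0 = 0 := by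
  obtain ⟨C, hC⟩ := hh.bound
  have hcont : Continuous fun s : ℝ => Complex.exp (-(b * s)) * h s := by
    have := hh.continuous; fun_prop
  set W : ℝ → ℂ := fun t => ∫ s in (0 : ℝ)..t, Complex.exp (-(b * s)) * h s with hW
  have hWd : ∀ t : ℝ, HasDerivAt W (Complex.exp (-(b * t)) * h t) t := fun t =>
    (hcont.integral_hasStrictDerivAt 0 t).hasDerivAt
  have hd : ∀ t : ℝ, HasDerivAt (fun t : ℝ => Complex.exp (b * t) * W t)
      (h t + b * (Complex.exp (b * t) * W t)) t := fun t => by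
    have h1 : HasDerivAt (fun t : ℝ => b * (t : ℂ)) (b * 1) t :=
      (Complex.ofRealCLM.hasDerivAt (x := t)).const_mul b
    refine (h1.cexp.mul (hWd t)).congr_deriv ?_
    have h2 : Complex.exp (b * t) * Complex.exp (-(b * t)) = 1 := by
      rw [← Complex.exp_add, add_neg_cancel, Complex.exp_zero]
    linear_combination h t * h2
  have hbd : ∀ s : ℝ, 0 ≤ s → ‖Complex.exp (-(b * s)) * h s‖ ≤ C * Real.exp (-(b.re + ε) * s) := by
    intro s hs
    rw [norm_mul, norm_exp_neg_mul_ofReal]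
    calc _ ≤ Real.exp (-b.re * s) * (C * Real.exp (-ε * s)) := by
          gcongr; exact hC s hs
      _ = _ := by rw [mul_left_comm, ← Real.exp_add]; ring_nf
  have hC0 : 0 ≤ C := by simpa using (norm_nonneg _).trans (hC 0 le_rfl)
  have hWb : ∃ D, ∀ t, 0 ≤ t → ‖W t‖ ≤ D * Real.exp (-(b.re + ε) * t) := by
    rcases hb with hb | ⟨hb, hz⟩
    · set r := -(b.re + ε) with hr
      have hr0 : 0 < r := by linarith
      refine ⟨C / r, fun t ht => ?_⟩
      calc ‖W t‖ ≤ ∫ s in (0 : ℝ)..t, C * Real.exp (r * s) :=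
            intervalIntegral.norm_integral_le_of_norm_le ht
              (Eventually.of_forall fun s hs => hbd s hs.1.le)
              (Continuous.intervalIntegrable (by fun_prop) _ _)
        _ = C / r * (Real.exp (r * t) - 1) := by
            rw [intervalIntegral.integral_const_mul, intervalIntegral.integral_comp_mul_left
              (fun x => Real.exp x) hr0.ne', integral_exp]
            simp; field_simp
        _ ≤ C / r * Real.exp (r * t) := by gcongr; linarith
    · have hr0 : -(b.re + ε) < 0 := by linarith
      refine ⟨C / (b.re + ε), fun t ht => ?_⟩
      have hI := (hh.exp_mul hb.le).integrableOn hε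
      have h1 : W t = -∫ s in Ioi t, Complex.exp (-(b * s)) * h s := by
        simp only [hW]
        rw [intervalIntegral.integral_of_le ht, eq_neg_iff_add_eq_zero,
          ← setIntegral_union (Ioc_disjoint_Ioi le_rfl) measurableSet_Ioi
          (hI.mono_set Ioc_subset_Ioi_self) (hI.mono_set (Ioi_subset_Ioi ht)),
          Ioc_union_Ioi_eq_Ioi ht]
        exact hz
      rw [h1, norm_neg]
      calc _ ≤ ∫ s in Ioi t, C * Real.exp (-(b.re + ε) * s) := by
            refine norm_integral_le_of_norm_le ((integrableOn_exp_mul_Ioi hr0 t).const_mul C) ?_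
            filter_upwards [ae_restrict_mem measurableSet_Ioi] with s hs
            exact hbd s (ht.trans (le_of_lt hs))
        _ = _ := by
            rw [integral_const_mul, integral_exp_mul_Ioi hr0]
            field_simp
  obtain ⟨D, hD⟩ := hWb
  refine ⟨fun t => Complex.exp (b * t) * W t,
    ⟨continuous_iff_continuousAt.2 fun t => (hd t).continuousAt, D, fun t ht => ?_⟩, hd,
    by simp [hW]⟩
  have he : ‖Complex.exp (b * t)‖ = Real.exp (b.re * t) := by rw [Complex.norm_exp]; simp
  rw [norm_mul, he]
  calc _ ≤ Real.exp (b.re * t) * (D * Real.exp (-(b.re + ε) * t)) := by gcongr; exact hD t ht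
    _ = _ := by rw [mul_left_comm, ← Real.exp_add]; ring_nf

/-- Multiplication of the Laplace transform by the factor `(μ + conj b) / (μ - b)` is realised by an
`L²`-isometry on exponentially decaying functions. -/
lemma exists_blaschke (hh : ExpDecay ε h) (hε : 0 < ε) {b : ℂ}
    (hb : b.re < -ε ∨ 0 < b.re ∧ laplaceIoi h b = 0) :
    ∃ g, ExpDecay ε g ∧ ∫ t in Ioi (0 : ℝ), ‖g t‖ ^ 2 = ∫ t in Ioi (0 : ℝ), ‖h t‖ ^ 2 ∧
      ∀ μ : ℂ, 0 < μ.re →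
        (μ - b) * laplaceIoi g μ = (μ + starRingEnd ℂ b) * laplaceIoi h μ := by
  obtain ⟨w, hw, hd, h0⟩ := hh.exists_hasDerivAt hε hb
  refine ⟨_, hh.add (hw.const_mul ((2 * b.re : ℝ) : ℂ)), hh.integral_norm_sq_eq hw hε hd h0,
    fun μ hμ => ?_⟩
  have h1 := hh.laplaceIoi_of_hasDerivAt hw hε hd h0 hμ.le
  rw [hh.laplaceIoi_add (hw.const_mul _) hε hμ.le, laplaceIoi_const_mul, ← h1]
  have h2 : ((2 * b.re : ℝ) : ℂ) = b + starRingEnd ℂ b := by rw [Complex.add_conj]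
  rw [h2]; ring

end ExpDecay

namespace ExpDecay

variable {ε : ℝ} {h : ℝ → ℂ}

lemma norm_laplaceIoi_le (hh : ExpDecay ε h) (hε : 0 < ε) {μ : ℂ} (hμ : 0 < μ.re) :
    ‖laplaceIoi h μ‖ ≤ 1 / (2 * μ.re) + ∫ t in Ioi (0 : ℝ), ‖h t‖ ^ 2 := by
  have hneg : -(2 * μ.re) < 0 := by linarith
  have hI := integrableOn_exp_mul_Ioi hneg 0
  have hsq := hh.integrableOn_norm_sq hε
  calc _ ≤ ∫ t in Ioi (0 : ℝ), (Real.exp (-(2 * μ.re) * t) + ‖h t‖ ^ 2) := by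
        refine norm_integral_le_of_norm_le (hI.add hsq) (Eventually.of_forall fun t => ?_)
        rw [norm_mul, norm_exp_neg_mul_ofReal]
        have : Real.exp (-(2 * μ.re) * t) = Real.exp (-μ.re * t) ^ 2 := by
          rw [← Real.exp_nat_mul]; ring_nf
        rw [this]
        nlinarith [sq_nonneg (Real.exp (-μ.re * t) - ‖h t‖), sq_nonneg (Real.exp (-μ.re * t)),
          sq_nonneg ‖h t‖]
    _ = _ := by
        rw [integral_add hI hsq, integral_exp_mul_Ioi hneg]
        simp

/-- Dividing the Laplace transform by the Blaschke factors of finitely many zeros. -/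
lemma exists_blaschke_quotient (hh : ExpDecay ε h) (hε : 0 < ε) {a : ℕ → ℂ}
    (ha : Function.Injective a) (hre : ∀ k, 0 < (a k).re) (hz : ∀ k, laplaceIoi h (a k) = 0)
    (N : ℕ) :
    ∃ g, ExpDecay ε g ∧ ∫ t in Ioi (0 : ℝ), ‖g t‖ ^ 2 = ∫ t in Ioi (0 : ℝ), ‖h t‖ ^ 2 ∧
      ∀ μ : ℂ, 0 < μ.re → (∏ k ∈ Finset.range N, (μ - a k)) * laplaceIoi g μ =
        (∏ k ∈ Finset.range N, (μ + starRingEnd ℂ (a k))) * laplaceIoi h μ := by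
  induction N with
  | zero => exact ⟨h, hh, rfl, by simp⟩
  | succ N ih =>
    obtain ⟨g, hg, hn, hL⟩ := ih
    have hgz : laplaceIoi g (a N) = 0 := by
      have := hL (a N) (hre N)
      rw [hz N, mul_zero, mul_eq_zero, Finset.prod_eq_zero_iff] at this
      refine this.resolve_left ?_
      rintro ⟨k, hk, hk'⟩
      exact (Finset.mem_range.1 hk).ne' (ha (sub_eq_zero.1 hk'))
    obtain ⟨g', hg', hn', hL'⟩ := hg.exists_blaschke hε (Or.inr ⟨hre N, hgz⟩)
    refine ⟨g', hg', hn'.trans hn, fun μ hμ => ?_⟩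
    rw [Finset.prod_range_succ, Finset.prod_range_succ, mul_assoc, hL' μ hμ]
    linear_combination (μ + starRingEnd ℂ (a N)) * hL μ hμ

/-- The Laplace transform of an exponentially decaying function vanishes identically if its zeros
violate the Blaschke condition. -/
lemma laplaceIoi_eq_zero (hh : ExpDecay ε h) (hε : 0 < ε) {a : ℕ → ℂ}
    (ha : Function.Injective a) {δ A : ℝ} (hδ : 0 < δ) (hre : ∀ k, δ ≤ (a k).re)
    (hA : ∀ k : ℕ, ‖a k‖ ≤ A * √(k + 1)) (hz : ∀ k, laplaceIoi h (a k) = 0)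
    {μ : ℂ} (hμ : 0 < μ.re) : laplaceIoi h μ = 0 := by
  have hA0 : 0 ≤ A := by simpa using (norm_nonneg _).trans (hA 0)
  set D := ‖μ‖ + A with hD
  have hD0 : 0 < D := by
    have : 0 < ‖μ‖ := norm_pos_iff.2 fun h => by simp [h] at hμ
    positivity
  set c := 2 * μ.re * δ / D ^ 2 with hc
  have hc0 : 0 < c := by positivity
  have hfac : ∀ k : ℕ, ‖μ - a k‖ ≤
      Real.exp (-c * (1 / ((k : ℝ) + 1))) * ‖μ + starRingEnd ℂ (a k)‖ := fun k => by
    have hk : (0 : ℝ) < (k : ℝ) + 1 := by positivity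
    have h1 : ‖μ + starRingEnd ℂ (a k)‖ ^ 2 ≤ D ^ 2 * ((k : ℝ) + 1) := by
      have hs : 1 ≤ √((k : ℝ) + 1) := Real.one_le_sqrt.2 (by simp)
      have : ‖μ + starRingEnd ℂ (a k)‖ ≤ D * √((k : ℝ) + 1) := by
        calc _ ≤ ‖μ‖ + ‖a k‖ := (norm_add_le _ _).trans (by simp)
          _ ≤ ‖μ‖ * √((k : ℝ) + 1) + A * √((k : ℝ) + 1) :=
            add_le_add (le_mul_of_one_le_right (norm_nonneg _) hs) (hA k)
          _ = _ := by rw [hD]; ring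
      calc _ ≤ (D * √((k : ℝ) + 1)) ^ 2 := by gcongr
        _ = _ := by rw [mul_pow, Real.sq_sqrt hk.le]
    have h2 : ‖μ - a k‖ ^ 2 =
        ‖μ + starRingEnd ℂ (a k)‖ ^ 2 - 4 * μ.re * (a k).re := by
      simp only [Complex.sq_norm, Complex.normSq_apply]
      simp
      ring
    have h3 : 2 * c * (1 / ((k : ℝ) + 1)) * ‖μ + starRingEnd ℂ (a k)‖ ^ 2 ≤
        4 * μ.re * (a k).re := by
      calc _ ≤ 2 * c * (1 / ((k : ℝ) + 1)) * (D ^ 2 * ((k : ℝ) + 1)) := by gcongr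
        _ = 4 * μ.re * δ := by rw [hc]; field_simp; ring
        _ ≤ _ := by gcongr; exact hre k
    refine (sq_le_sq₀ (norm_nonneg _) (by positivity)).1 ?_
    rw [mul_pow, ← Real.exp_nat_mul]
    have h4 := Real.add_one_le_exp (((2 : ℕ) : ℝ) * (-c * (1 / ((k : ℝ) + 1))))
    have h5 := mul_le_mul_of_nonneg_right h4 (sq_nonneg ‖μ + starRingEnd ℂ (a k)‖)
    refine le_trans ?_ h5
    rw [h2]; push_cast; linarith
  set B := 1 / (2 * μ.re) + ∫ t in Ioi (0 : ℝ), ‖h t‖ ^ 2 with hB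
  have hbound : ∀ N : ℕ, ‖laplaceIoi h μ‖ ≤
      B * Real.exp (-c * ∑ k ∈ Finset.range N, 1 / ((k : ℝ) + 1)) := fun N => by
    obtain ⟨g, hg, hn, hL⟩ := hh.exists_blaschke_quotient hε ha
      (fun k => hδ.trans_le (hre k)) hz N
    have hgB : ‖laplaceIoi g μ‖ ≤ B := by
      rw [hB, ← hn]; exact hg.norm_laplaceIoi_le hε hμ
    have hP : 0 < ‖∏ k ∈ Finset.range N, (μ + starRingEnd ℂ (a k))‖ := by
      rw [norm_pos_iff, Finset.prod_ne_zero_iff]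
      intro k _ h0
      have := congrArg Complex.re h0
      simp at this
      linarith [hre k]
    have hQ : ‖∏ k ∈ Finset.range N, (μ - a k)‖ ≤
        Real.exp (-c * ∑ k ∈ Finset.range N, 1 / ((k : ℝ) + 1)) *
          ‖∏ k ∈ Finset.range N, (μ + starRingEnd ℂ (a k))‖ := by
      rw [norm_prod, norm_prod, Finset.mul_sum, Real.exp_sum, ← Finset.prod_mul_distrib]
      exact Finset.prod_le_prod (fun _ _ => norm_nonneg _) fun k _ => hfac k
    have hE := congrArg norm (hL μ hμ)
    rw [norm_mul, norm_mul] at hE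
    refine le_of_mul_le_mul_left ?_ hP
    rw [← hE]
    calc _ ≤ (Real.exp (-c * ∑ k ∈ Finset.range N, 1 / ((k : ℝ) + 1)) *
          ‖∏ k ∈ Finset.range N, (μ + starRingEnd ℂ (a k))‖) * B := by gcongr
      _ = _ := by ring
  have hlim : Tendsto (fun N : ℕ =>
      B * Real.exp (-c * ∑ k ∈ Finset.range N, 1 / ((k : ℝ) + 1))) atTop (nhds 0) := by
    have := Real.tendsto_exp_atBot.comp
      (Real.tendsto_sum_range_one_div_nat_succ_atTop.const_mul_atTop_of_neg (neg_lt_zero.2 hc0))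
    simpa using this.const_mul B
  exact norm_le_zero_iff.1 (ge_of_tendsto' hlim hbound)

/-- Uniqueness for the Laplace transform, from Fourier inversion. -/
lemma eq_zero_of_laplaceIoi (hh : ExpDecay ε h) (hε : 0 < ε) (hneg : ∀ t ≤ 0, h t = 0)
    (hz : ∀ μ : ℂ, 0 < μ.re → laplaceIoi h μ = 0) (t : ℝ) : h t = 0 := by
  set K : ℝ → ℂ := fun t => Complex.exp (-((1 : ℂ) * t)) * h t with hK
  have hKd : ExpDecay ε K := hh.exp_mul (by simp)
  have hsupp : ∀ c : ℝ → ℂ, ∀ t, t ∉ Ioi (0 : ℝ) → c t * K t = 0 := fun c t ht => by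
    simp [hK, hneg t (not_lt.1 ht)]
  have hinteg : Integrable K := by
    rw [← integrableOn_iff_integrable_of_support_subset (s := Ioi (0 : ℝ))]
    · exact hKd.integrableOn hε
    · intro t ht
      by_contra h'
      exact ht (by simpa using hsupp 1 t h')
  have hF : FourierTransform.fourier K = 0 := by
    funext w
    rw [Real.fourier_real_eq_integral_exp_smul]
    simp only [smul_eq_mul]
    rw [← setIntegral_eq_integral_of_forall_compl_eq_zero (s := Ioi (0 : ℝ))
      (fun t ht => hsupp (fun v => Complex.exp (↑(-2 * Real.pi * v * w) * Complex.I)) t ht)]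
    have := hz (1 + 2 * Real.pi * w * Complex.I) (by simp)
    rw [laplaceIoi] at this
    simp only [Pi.zero_apply]
    rw [← this]
    congr 1 with t
    rw [hK, ← mul_assoc, ← Complex.exp_add]
    congr 2
    push_cast
    ring
  have := hinteg.fourierInv_fourier_eq (by rw [hF]; exact integrable_zero _ _ _)
    (hKd.continuous.continuousAt (x := t))
  rw [hF] at this
  have h0 : K t = 0 := by
    rw [← this, Real.fourierInv_eq]
    simp
  simpa [hK] using h0

end ExpDecay

/-- The primitive of an integrable function on `(0, ∞)` vanishes only if the function does. -/
lemma ae_eq_zero_of_integral_Ioc_eq_zero {h : ℝ → ℂ} (hh : Integrable h) (hneg : ∀ t ≤ 0, h t = 0)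
    {T : ℝ} (hz : ∀ t ∈ Ioo 0 T, ∫ s in (0 : ℝ)..t, h s = 0) :
    ∀ᵐ t, t < T → h t = 0 := by
  filter_upwards [_root_.LocallyIntegrable.ae_hasDerivAt_integral hh.locallyIntegrable] with t ht htT
  rcases le_or_gt t 0 with h0 | h0
  · exact hneg t h0
  have h1 : HasDerivAt (fun _ : ℝ => (0 : ℂ)) (h t) t := by
    refine (ht 0).congr_of_eventuallyEq ?_
    filter_upwards [Ioo_mem_nhds h0 htT] with u hu using (hz u hu).symm
  exact h1.unique (hasDerivAt_const _ _)

/-- Exponentials whose exponents violate the Blaschke condition separate `L¹(0, ∞)`. -/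
lemma separates_exp {y : ℕ → ℝ} (hy : Function.Injective y) {δ A : ℝ} (hδ : 0 < δ)
    (hA : ∀ k : ℕ, |y k| ≤ A * √(k + 1)) :
    Separates (volume.restrict (Ioi (0 : ℝ)))
      (fun (k : ℕ) (u : ℝ) => Complex.exp (-((δ + Complex.I * y k) * |u|))) := by
  intro h hh hz
  set h₀ : ℝ → ℂ := (Ioi (0 : ℝ)).indicator h with hh₀
  have hi₀ : Integrable h₀ := (integrable_indicator_iff measurableSet_Ioi).2 hh
  have hneg₀ : ∀ t ≤ 0, h₀ t = 0 := fun t ht => indicator_of_notMem (not_lt.2 ht) _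
  set H : ℝ → ℂ := fun u => ∫ s in (0 : ℝ)..u, h₀ s with hH
  have hHc : Continuous H := intervalIntegral.continuous_primitive
    (fun _ _ => hi₀.intervalIntegrable) 0
  have hHneg : ∀ t ≤ 0, H t = 0 := fun t ht => by
    simp only [hH]
    rw [intervalIntegral.integral_congr (g := fun _ => 0)]
    · simp
    · intro s hs
      rw [uIcc_of_ge ht] at hs
      exact hneg₀ s hs.2
  have hHb : ∀ t, ‖H t‖ ≤ ∫ s, ‖h₀ s‖ := fun t => by
    refine intervalIntegral.norm_integral_le_integral_norm_uIoc.trans ?_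
    exact setIntegral_le_integral hi₀.norm (Eventually.of_forall fun _ => norm_nonneg _)
  have hHeq : ∀ u, 0 < u → ∫ s in Ioi (0 : ℝ), (Iic u).indicator h s = H u := fun u hu => by
    simp only [hH]
    rw [intervalIntegral.integral_of_le hu.le, integral_indicator measurableSet_Iic,
      Measure.restrict_restrict measurableSet_Iic, hh₀]
    rw [setIntegral_indicator measurableSet_Ioi]
    congr 2
    ext s; simp only [mem_inter_iff, mem_Iic, mem_Ioi, mem_Ioc]; tauto
  set x : ℝ → ℂ := fun u => Complex.exp (-(((δ / 2 : ℝ) : ℂ) * u)) * H u with hx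
  have hxd : ExpDecay (δ / 2) x := by
    refine ⟨by fun_prop, ∫ s, ‖h₀ s‖, fun t _ => ?_⟩
    rw [hx]
    simp only
    rw [norm_mul, norm_exp_neg_mul_ofReal, mul_comm]
    simp only [Complex.ofReal_re]
    exact mul_le_mul_of_nonneg_right (hHb t) (Real.exp_pos _).le
  have hxz : ∀ k, laplaceIoi x (((δ / 2 : ℝ) : ℂ) + Complex.I * y k) = 0 := fun k => by
    set z : ℂ := δ + Complex.I * y k with hzdef
    have hzre : z.re = δ := by simp [hzdef]
    have hz0 : z ≠ 0 := fun h0 => by rw [h0] at hzre; simp at hzre; linarith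
    have hnz : (-z).re < 0 := by simp [hzre, hδ]
    have hψ : Integrable (fun u : ℝ => Complex.exp (-z * u)) (volume.restrict (Ioi (0 : ℝ))) :=
      integrableOn_exp_mul_complex_Ioi hnz 0
    have hF := integral_mul_integral_Iic_indicator hh hψ
    have hR : ∫ s in Ioi (0 : ℝ), h s * ∫ u in Ioi (0 : ℝ),
        (Ici s).indicator (fun u : ℝ => Complex.exp (-z * u)) u = 0 := by
      have h1 : ∀ s ∈ Ioi (0 : ℝ), h s * ∫ u in Ioi (0 : ℝ),
          (Ici s).indicator (fun u : ℝ => Complex.exp (-z * u)) u =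
          z⁻¹ * (Complex.exp (-(z * |s|)) * h s) := fun s hs => by
        rw [integral_indicator measurableSet_Ici, Measure.restrict_restrict measurableSet_Ici,
          inter_eq_left.2 (Ici_subset_Ioi.2 hs), integral_Ici_eq_integral_Ioi,
          integral_exp_mul_complex_Ioi hnz, abs_of_pos hs, neg_mul]
        field_simp
      rw [setIntegral_congr_fun measurableSet_Ioi h1, integral_const_mul, hz k, mul_zero]
    rw [hR] at hF
    rw [laplaceIoi, ← hF]
    refine setIntegral_congr_fun measurableSet_Ioi fun u hu => ?_
    rw [hHeq u hu, hx, ← mul_assoc, ← Complex.exp_add]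
    congr 2
    rw [hzdef]; push_cast; ring
  have hinj : Function.Injective fun k => ((δ / 2 : ℝ) : ℂ) + Complex.I * y k := by
    intro k l hkl
    have := congrArg Complex.im hkl
    simp at this
    exact hy this
  have hxL : ∀ μ : ℂ, 0 < μ.re → laplaceIoi x μ = 0 := fun μ hμ => by
    refine hxd.laplaceIoi_eq_zero (half_pos hδ) hinj (δ := δ / 2) (A := δ / 2 + A) (half_pos hδ)
      (fun k => by simp) (fun k => ?_) hxz hμ
    have hs : 1 ≤ √((k : ℝ) + 1) := Real.one_le_sqrt.2 (by simp)
    refine (norm_add_le _ _).trans ?_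
    rw [norm_mul, Complex.norm_I, one_mul, Complex.norm_real, Complex.norm_real,
      Real.norm_eq_abs, Real.norm_eq_abs, abs_of_pos (half_pos hδ), add_mul]
    exact add_le_add (le_mul_of_one_le_right (half_pos hδ).le hs) (hA k)
  have hH0 : ∀ t, H t = 0 := fun t => by
    have := hxd.eq_zero_of_laplaceIoi (half_pos hδ) (fun t ht => by simp [hx, hHneg t ht]) hxL t
    simpa [hx] using this
  refine (ae_restrict_iff' measurableSet_Ioi).2 ?_
  have h1 : ∀ᵐ t : ℝ, ∀ n : ℕ, t < n → h₀ t = 0 := ae_all_iff.2 fun n =>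
    ae_eq_zero_of_integral_Ioc_eq_zero hi₀ hneg₀ fun t _ => hH0 t
  filter_upwards [h1] with t ht ht0
  obtain ⟨n, hn⟩ := exists_nat_gt t
  have := ht n hn
  rwa [hh₀, indicator_of_mem ht0] at this

/-- The ramps `s ↦ max (q - s) 0` with rational `q` separate `L¹(0, T]`. -/
lemma separates_ramp (T : ℝ) :
    Separates (volume.restrict (Ioc (0 : ℝ) T))
      (fun (q : {q : ℚ // (0 : ℝ) < q ∧ (q : ℝ) ≤ T}) (s : ℝ) =>
        ((max ((q : ℚ) - |s|) 0 : ℝ) : ℂ)) := by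
  intro h hh hz
  set h₀ : ℝ → ℂ := (Ioc (0 : ℝ) T).indicator h with hh₀
  have hi₀ : Integrable h₀ := (integrable_indicator_iff measurableSet_Ioc).2 hh
  have hneg₀ : ∀ t ≤ 0, h₀ t = 0 := fun t ht => indicator_of_notMem (fun h => not_lt.2 ht h.1) _
  set H : ℝ → ℂ := fun u => ∫ s in (0 : ℝ)..u, h₀ s with hH
  have hHc : Continuous H := intervalIntegral.continuous_primitive
    (fun _ _ => hi₀.intervalIntegrable) 0
  set P : ℝ → ℂ := fun q => ∫ u in (0 : ℝ)..q, H u with hP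
  have hPd : ∀ q, HasDerivAt P (H q) q := fun q => (hHc.integral_hasStrictDerivAt 0 q).hasDerivAt
  have hPc : Continuous P := continuous_iff_continuousAt.2 fun q => (hPd q).continuousAt
  have hPq : ∀ q : ℚ, (0 : ℝ) < q → (q : ℝ) ≤ T → P q = 0 := fun q hq0 hqT => by
    have hr : Integrable h (volume.restrict (Ioc (0 : ℝ) q)) :=
      IntegrableOn.mono_set hh (Ioc_subset_Ioc_right hqT)
    have hF := integral_mul_integral_Iic_indicator hr
      (integrable_const (1 : ℂ) (μ := volume.restrict (Ioc (0 : ℝ) q)))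
    have hR : ∫ s in Ioc (0 : ℝ) q, h s * ∫ u in Ioc (0 : ℝ) q,
        (Ici s).indicator (fun _ : ℝ => (1 : ℂ)) u =
        ∫ s in Ioc (0 : ℝ) T, ((max ((q : ℚ) - |s|) 0 : ℝ) : ℂ) * h s := by
      rw [setIntegral_eq_of_subset_of_forall_sdiff_eq_zero measurableSet_Ioc
        (Ioc_subset_Ioc_right hqT)
        (f := fun s => ((max ((q : ℚ) - |s|) 0 : ℝ) : ℂ) * h s)]
      · refine setIntegral_congr_fun measurableSet_Ioc fun s hs => ?_
        rw [integral_indicator measurableSet_Ici, Measure.restrict_restrict measurableSet_Ici]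
        have : Ici s ∩ Ioc 0 (q : ℝ) = Icc s q := by
          ext u; simp only [mem_inter_iff, mem_Ici, mem_Ioc, mem_Icc]
          exact ⟨fun h => ⟨h.1, h.2.2⟩, fun h => ⟨h.1, hs.1.trans_le h.1, h.2⟩⟩
        rw [this, abs_of_pos hs.1, max_eq_left (sub_nonneg.2 hs.2), mul_comm]
        simp [hs.2]
      · intro s hs
        have : (q : ℝ) < s := by
          by_contra h'
          exact hs.2 ⟨hs.1.1, not_lt.1 h'⟩
        rw [abs_of_pos hs.1.1, max_eq_right (by linarith)]
        simp
    rw [hR, hz ⟨q, hq0, hqT⟩] at hF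
    simp only [hP]
    rw [← hF, intervalIntegral.integral_of_le hq0.le]
    refine setIntegral_congr_fun measurableSet_Ioc fun u hu => ?_
    simp only [one_mul, hH]
    rw [intervalIntegral.integral_of_le hu.1.le, integral_indicator measurableSet_Iic,
      Measure.restrict_restrict measurableSet_Iic, hh₀, setIntegral_indicator measurableSet_Ioc]
    congr 2
    ext s; simp only [mem_inter_iff, mem_Iic, mem_Ioc]
    grind
  have hP0 : ∀ q ∈ Ioo 0 T, P q = 0 := by
    intro q hq
    by_contra hne
    have hev : ∀ᶠ p in nhds q, P p ≠ 0 ∧ p ∈ Ioo 0 T :=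
      (hPc.continuousAt.eventually_ne hne).and (Ioo_mem_nhds hq.1 hq.2)
    obtain ⟨r, hr⟩ := Rat.denseRange_cast.exists_mem_open isOpen_interior
      ⟨q, mem_interior_iff_mem_nhds.2 hev⟩
    have hr' := interior_subset hr
    exact hr'.1 (hPq r hr'.2.1 hr'.2.2.le)
  have hH0 : ∀ q ∈ Ioo 0 T, H q = 0 := fun q hq => by
    have h1 : HasDerivAt (fun _ : ℝ => (0 : ℂ)) (H q) q :=
      (hPd q).congr_of_eventuallyEq (by
        filter_upwards [Ioo_mem_nhds hq.1 hq.2] with u hu using (hP0 u hu).symm)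
    exact h1.unique (hasDerivAt_const _ _)
  refine (ae_restrict_iff' measurableSet_Ioc).2 ?_
  have hT : ∀ᵐ t : ℝ, t ≠ T := by simp [ae_iff]
  filter_upwards [ae_eq_zero_of_integral_Ioc_eq_zero hi₀ hneg₀ hH0, hT] with t ht htT htm
  have := ht (lt_of_le_of_ne htm.2 htT)
  rwa [hh₀, indicator_of_mem htm] at this

section Orthant

variable {n : ℕ} {f : (Fin n → ℝ) → ℂ}

lemma restrict_pi_volume (S : Fin n → Set ℝ) :
    (volume : Measure (Fin n → ℝ)).restrict (univ.pi S) =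
      Measure.pi fun i => volume.restrict (S i) := by
  rw [volume_pi, Measure.restrict_pi_pi]

lemma integrableOn_exp_mul_box (hf : LocallyIntegrableOn f {t | ∀ i, 0 ≤ t i}) (l : Fin n → ℂ)
    (t : Fin n → ℝ) :
    IntegrableOn (fun s : Fin n → ℝ => Complex.exp (-(∑ i, l i * (s i : ℂ))) * f s)
      (univ.pi fun i => Ioc 0 (t i)) := by
  have hsub : (univ.pi fun i => Ioc 0 (t i)) ⊆ Icc 0 t := fun s hs =>
    ⟨fun i => (hs i trivial).1.le, fun i => (hs i trivial).2⟩
  have h1 : IntegrableOn f (Icc 0 t) :=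
    hf.integrableOn_compact_subset (fun s hs i => hs.1 i) isCompact_Icc
  have hc : Continuous fun s : Fin n → ℝ => Complex.exp (-(∑ i, l i * (s i : ℂ))) := by fun_prop
  exact (h1.continuousOn_mul hc.continuousOn isCompact_Icc).mono_set hsub

/-- Integrating a product function against the box primitive `mLapPartial n f c`. -/
lemma integral_prod_mul_mLapPartial (hf : LocallyIntegrableOn f {t | ∀ i, 0 ≤ t i})
    (c : Fin n → ℂ) {ψ : Fin n → ℝ → ℂ} (hψ : ∀ i, Continuous (ψ i)) (t : Fin n → ℝ) :
    ∫ u in univ.pi fun i => Ioc 0 (t i), (∏ i, ψ i (u i)) * mLapPartial n f c u =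
      ∫ s in univ.pi fun i => Ioc 0 (t i),
        (Complex.exp (-(∑ i, c i * s i)) * f s) * ∏ i, ∫ u in Icc (s i) (t i), ψ i u := by
  set B : Set (Fin n → ℝ) := univ.pi fun i => Ioc 0 (t i) with hB
  have hBm : MeasurableSet B := MeasurableSet.univ_pi fun i => measurableSet_Ioc
  have hψi : Integrable (fun u : Fin n → ℝ => ∏ i, ψ i (u i)) (volume.restrict B) := by
    rw [hB, restrict_pi_volume]
    exact Integrable.fintype_prod fun i => ((hψ i).integrableOn_Icc).mono_set Ioc_subset_Icc_self
  have hF := integral_mul_integral_Iic_indicator (integrableOn_exp_mul_box hf c t) hψi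
  have hL : ∀ u ∈ B, (∏ i, ψ i (u i)) * mLapPartial n f c u = (∏ i, ψ i (u i)) *
      ∫ s in B, (Iic u).indicator (fun s => Complex.exp (-(∑ i, c i * s i)) * f s) s := by
    intro u hu
    rw [integral_indicator measurableSet_Iic, Measure.restrict_restrict measurableSet_Iic,
      mLapPartial]
    congr 3
    ext s
    simp only [hB, mem_univ_pi, mem_inter_iff, mem_Iic, mem_Ioc, Pi.le_def] at hu ⊢
    exact ⟨fun h => ⟨fun i => (h i).2, fun i => ⟨(h i).1, (h i).2.trans (hu i).2⟩⟩,
      fun h i => ⟨(h.2 i).1, h.1 i⟩⟩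
  rw [setIntegral_congr_fun hBm hL, hF]
  refine setIntegral_congr_fun hBm fun s hs => ?_
  congr 1
  rw [integral_indicator measurableSet_Ici, Measure.restrict_restrict measurableSet_Ici]
  have : Ici s ∩ B = univ.pi fun i => Icc (s i) (t i) := by
    ext u
    simp only [hB, mem_univ_pi, mem_inter_iff, mem_Ici, mem_Ioc, Pi.le_def, mem_Icc] at hs ⊢
    exact ⟨fun h i => ⟨h.1 i, (h.2 i).2⟩,
      fun h => ⟨fun i => (h i).1, fun i => ⟨(hs i).1.trans_le (h i).1, (h i).2⟩⟩⟩
  rw [this, restrict_pi_volume, integral_fintype_prod_eq_prod]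

lemma integral_Icc_mul_exp {μ : ℂ} (hμ : μ ≠ 0) {s t : ℝ} (hst : s ≤ t) :
    ∫ u in Icc s t, μ * Complex.exp (-(μ * u)) =
      Complex.exp (-(μ * s)) - Complex.exp (-(μ * t)) := by
  rw [integral_Icc_eq_integral_Ioc, ← intervalIntegral.integral_of_le hst,
    intervalIntegral.integral_const_mul]
  simp only [← neg_mul]
  rw [integral_exp_mul_complex (neg_ne_zero.2 hμ)]
  field_simp
  ring

/-- Expansion of the integral against the box primitive into partial Laplace integrals. -/
lemma integral_box_exp_mul_mLapPartial (hf : LocallyIntegrableOn f {t | ∀ i, 0 ≤ t i})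
    {c l : Fin n → ℂ} (hlc : ∀ i, l i - c i ≠ 0) (t : Fin n → ℝ) :
    (∏ i, (l i - c i)) * ∫ u in univ.pi fun i => Ioc 0 (t i),
        (∏ i, Complex.exp (-((l i - c i) * u i))) * mLapPartial n f c u =
      ∑ S : Finset (Fin n), ((-1) ^ S.card * ∏ i ∈ S, Complex.exp (-((l i - c i) * t i))) *
        mLapPartial n f (fun i => if i ∈ S then c i else l i) t := by
  have hBm : MeasurableSet (univ.pi fun i => Ioc 0 (t i) : Set (Fin n → ℝ)) :=
    MeasurableSet.univ_pi fun i => measurableSet_Ioc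
  have h1 := integral_prod_mul_mLapPartial hf c
    (ψ := fun i u => (l i - c i) * Complex.exp (-((l i - c i) * u))) (fun i => by fun_prop) t
  simp only [Finset.prod_mul_distrib, mul_assoc] at h1
  rw [integral_const_mul] at h1
  rw [h1]
  simp only [mLapPartial, ← integral_const_mul]
  rw [← integral_finsetSum _ fun S _ => (integrableOn_exp_mul_box hf _ t).const_mul _]
  refine setIntegral_congr_fun hBm fun s hs => ?_
  rw [Finset.prod_congr rfl fun i _ => integral_Icc_mul_exp (hlc i) (hs i trivial).2,
    Finset.prod_sub, Finset.powerset_univ, ← mul_assoc, Finset.mul_sum]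
  refine Finset.sum_congr rfl fun S _ => ?_
  have h2 : Complex.exp (-(∑ i, (if i ∈ S then c i else l i) * s i)) =
      Complex.exp (-(∑ i, c i * s i)) *
        ∏ i ∈ Finset.univ \ S, Complex.exp (-((l i - c i) * s i)) := by
    rw [← Complex.exp_sum, ← Complex.exp_add, Finset.sum_neg_distrib, ← neg_add,
      ← Finset.sum_sdiff (Finset.subset_univ S), ← Finset.sum_sdiff (Finset.subset_univ S)]
    congr 2
    rw [Finset.sum_congr rfl (g := fun i => l i * s i) fun i hi => by
        rw [if_neg (Finset.mem_sdiff.1 hi).2],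
      Finset.sum_congr (s₁ := S) rfl (g := fun i => c i * s i) fun i hi => by rw [if_pos hi]]
    have h3 : ∑ i ∈ Finset.univ \ S, l i * (s i : ℂ) =
        ∑ i ∈ Finset.univ \ S, c i * (s i : ℂ) +
          ∑ i ∈ Finset.univ \ S, (l i - c i) * (s i : ℂ) := by
      rw [← Finset.sum_add_distrib]
      exact Finset.sum_congr rfl fun i _ => by ring
    rw [h3]; ring
  rw [h2]; ring

lemma tendsto_const_nat_atTop : Tendsto (fun (m : ℕ) (_ : Fin n) => (m : ℝ)) atTop atTop := by
  refine tendsto_atTop.2 fun b => ?_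
  exact eventually_all.2 fun i => tendsto_natCast_atTop_atTop.eventually_ge_atTop (b i)

lemma monotone_natBox : Monotone fun m : ℕ => (univ.pi fun _ : Fin n => Ioc (0 : ℝ) m) :=
  fun _ _ h => Set.pi_mono fun _ _ => Ioc_subset_Ioc_right (Nat.cast_le.2 h)

lemma iUnion_natBox :
    ⋃ m : ℕ, (univ.pi fun _ : Fin n => Ioc (0 : ℝ) m) = univ.pi fun _ => Ioi (0 : ℝ) := by
  ext s
  simp only [mem_iUnion, mem_univ_pi, mem_Ioc, mem_Ioi]
  refine ⟨fun ⟨m, h⟩ i => (h i).1, fun h => ?_⟩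
  obtain ⟨m, hm⟩ := (tendsto_const_nat_atTop.eventually_ge_atTop s).exists
  exact ⟨m, fun i => ⟨h i, hm i⟩⟩

lemma aestronglyMeasurable_mLapPartial (hf : LocallyIntegrableOn f {t | ∀ i, 0 ≤ t i})
    (c : Fin n → ℂ) :
    AEStronglyMeasurable (mLapPartial n f c) (volume.restrict (univ.pi fun _ => Ioi (0 : ℝ))) := by
  set O : Set (Fin n → ℝ) := univ.pi fun _ => Ioi (0 : ℝ) with hO
  have hOm : MeasurableSet O := MeasurableSet.univ_pi fun i => measurableSet_Ioi
  have hg : AEStronglyMeasurable (fun s => Complex.exp (-(∑ i, c i * s i)) * f s)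
      (volume.restrict O) := by
    have h1 : AEStronglyMeasurable f (volume.restrict O) :=
      hf.aestronglyMeasurable.mono_measure
        (Measure.restrict_mono (fun s hs i => (hs i trivial).le) le_rfl)
    exact (Continuous.aestronglyMeasurable (by fun_prop)).mul h1
  have hm : MeasurableSet {p : (Fin n → ℝ) × (Fin n → ℝ) | p.2 ≤ p.1} :=
    measurableSet_le measurable_snd measurable_fst
  have h2 := ((hg.comp_snd (μ := volume.restrict O)).indicator hm).integral_prod_right'
  refine h2.congr ?_
  filter_upwards [ae_restrict_mem hOm] with u hu
  have h3 : ∀ s, {p : (Fin n → ℝ) × (Fin n → ℝ) | p.2 ≤ p.1}.indicator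
      (fun z => Complex.exp (-(∑ i, c i * z.2 i)) * f z.2) (u, s) =
      (Iic u).indicator (fun s => Complex.exp (-(∑ i, c i * s i)) * f s) s := fun s => by
    by_cases hs : s ≤ u <;> simp [indicator, hs]
  simp only [h3]
  rw [integral_indicator measurableSet_Iic, Measure.restrict_restrict measurableSet_Iic,
    mLapPartial]
  congr 2
  ext s
  simp only [hO, mem_univ_pi, mem_inter_iff, mem_Iic, mem_Ioc, mem_Ioi, Pi.le_def]
  exact ⟨fun h i => ⟨h.2 i, h.1 i⟩, fun h => ⟨fun i => (h i).2, fun i => (h i).1⟩⟩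

end Orthant

section Uniqueness

variable {n : ℕ} {f : (Fin n → ℝ) → ℂ}

lemma exists_bound_of_mem_mOmegaB {l : Fin n → ℂ} (h : l ∈ mOmegaB n f) :
    ∃ C, ∀ t : Fin n → ℝ, (∀ i, 0 ≤ t i) → ‖mLapPartial n f l t‖ ≤ C := by
  have h' : Bornology.IsBounded (mLapPartial n f l '' {t | ∀ i, 0 ≤ t i}) := h
  obtain ⟨C, hC⟩ := isBounded_iff_forall_norm_le.1 h'
  exact ⟨C, fun t ht => hC _ ⟨t, ht, rfl⟩⟩

lemma integrableOn_prod_exp_mul_of_bounded {G : (Fin n → ℝ) → ℂ} {C : ℝ} {μ : Fin n → ℂ}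
    (hμ : ∀ i, 0 < (μ i).re)
    (hG : AEStronglyMeasurable G (volume.restrict (univ.pi fun _ => Ioi (0 : ℝ))))
    (hC : ∀ u : Fin n → ℝ, (∀ i, 0 ≤ u i) → ‖G u‖ ≤ C) :
    IntegrableOn (fun u : Fin n → ℝ => (∏ i, Complex.exp (-(μ i * (u i : ℂ)))) * G u)
      (univ.pi fun _ => Ioi (0 : ℝ)) := by
  have hOm : MeasurableSet (univ.pi fun _ : Fin n => Ioi (0 : ℝ)) :=
    MeasurableSet.univ_pi fun i => measurableSet_Ioi
  have h1 : Integrable (fun u : Fin n → ℝ => ∏ i, Complex.exp (-(μ i * (u i : ℂ))))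
      (volume.restrict (univ.pi fun _ => Ioi (0 : ℝ))) := by
    rw [restrict_pi_volume]
    refine Integrable.fintype_prod (f := fun i (t : ℝ) => Complex.exp (-(μ i * (t : ℂ))))
      fun i => ?_
    have h := integrableOn_exp_mul_complex_Ioi (a := -μ i) (by simpa using hμ i) 0
    simp only [neg_mul] at h
    exact h
  refine h1.mul_bdd (c := C) hG ?_
  filter_upwards [ae_restrict_mem hOm] with u hu
  exact hC u fun i => (hu i trivial).le

/-- If the Laplace transform of `f` vanishes at `l`, so does that of its box primitive at
`l - c`. -/
lemma integral_exp_mul_mLapPartial_eq_zero (hf : LocallyIntegrableOn f {t | ∀ i, 0 ≤ t i})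
    {c l : Fin n → ℂ} (hlc : ∀ i, (c i).re < (l i).re)
    (hb : ∀ S : Finset (Fin n), (fun i => if i ∈ S then c i else l i) ∈ mOmegaB n f)
    (hl : HasMLaplace n f l 0) :
    ∫ u in univ.pi fun _ => Ioi (0 : ℝ),
      (∏ i, Complex.exp (-((l i - c i) * (u i : ℂ)))) * mLapPartial n f c u = 0 := by
  have hne : ∀ i, l i - c i ≠ 0 := fun i h => by
    have := congrArg Complex.re h
    simp only [Complex.sub_re, Complex.zero_re] at this
    linarith [hlc i]
  obtain ⟨C, hC⟩ := exists_bound_of_mem_mOmegaB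
    (show c ∈ mOmegaB n f by simpa using hb Finset.univ)
  have hinteg := integrableOn_prod_exp_mul_of_bounded (μ := fun i => l i - c i)
    (fun i => by simpa using hlc i) (aestronglyMeasurable_mLapPartial hf c) hC
  rw [← iUnion_natBox] at hinteg ⊢
  have hlim := tendsto_setIntegral_of_monotone
    (fun m : ℕ => MeasurableSet.univ_pi fun _ => measurableSet_Ioc) (monotone_natBox (n := n)) hinteg
  have hlim' := hlim.const_mul (∏ i, (l i - c i))
  have hz : Tendsto (fun m : ℕ => ∑ S : Finset (Fin n),
      ((-1) ^ S.card * ∏ i ∈ S, Complex.exp (-((l i - c i) * ((m : ℝ) : ℂ)))) *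
        mLapPartial n f (fun i => if i ∈ S then c i else l i) fun _ => (m : ℝ)) atTop
      (nhds (∑ S : Finset (Fin n), 0)) := by
    refine tendsto_finsetSum _ fun S _ => ?_
    rcases S.eq_empty_or_nonempty with rfl | ⟨j, hj⟩
    · have h := hl.comp (tendsto_const_nat_atTop (n := n))
      simp only [Finset.card_empty, pow_zero, Finset.prod_empty, one_mul, Finset.notMem_empty,
        if_false]
      exact h
    · obtain ⟨D, hD⟩ := exists_bound_of_mem_mOmegaB (hb S)
      simp only [mul_comm _ (mLapPartial n f _ _)]
      refine isBoundedUnder_le_mul_tendsto_zero (isBoundedUnder_of ⟨D, fun m : ℕ =>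
        hD (fun _ => (m : ℝ)) fun _ => m.cast_nonneg⟩) ?_
      have hexp : ∀ (i : Fin n) (m : ℕ),
          ‖Complex.exp (-((l i - c i) * ((m : ℝ) : ℂ)))‖ =
            Real.exp (-(((l i).re - (c i).re) * m)) := fun i m => by
        rw [norm_exp_neg_mul_ofReal, Complex.sub_re, neg_mul]
      have hj0 : Tendsto (fun m : ℕ => Real.exp (-(((l j).re - (c j).re) * m))) atTop (nhds 0) :=
        Real.tendsto_exp_neg_atTop_nhds_zero.comp
          (tendsto_natCast_atTop_atTop.const_mul_atTop (sub_pos.2 (hlc j)))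
      refine squeeze_zero_norm (fun m => ?_) hj0
      rw [norm_mul, norm_pow, norm_neg, norm_one, one_pow, one_mul, norm_prod,
        ← Finset.mul_prod_erase _ _ hj, hexp]
      refine mul_le_of_le_one_right (Real.exp_pos _).le
        (Finset.prod_le_one (fun _ _ => norm_nonneg _) fun i _ => ?_)
      rw [hexp, Real.exp_le_one_iff, neg_nonpos]
      exact mul_nonneg (sub_pos.2 (hlc i)).le m.cast_nonneg
  have heq := tendsto_nhds_unique hlim' (hz.congr fun m =>
    (integral_box_exp_mul_mLapPartial hf hne fun _ => (m : ℝ)).symm)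
  rw [Finset.sum_const_zero] at heq
  exact (mul_eq_zero.1 heq).resolve_left (Finset.prod_ne_zero_iff.2 fun i _ => hne i)

/-- A box primitive that vanishes almost everywhere comes from an almost everywhere vanishing
function. -/
lemma ae_eq_zero_of_mLapPartial_ae_eq_zero (hf : LocallyIntegrableOn f {t | ∀ i, 0 ≤ t i})
    {c : Fin n → ℂ}
    (hG : mLapPartial n f c =ᵐ[volume.restrict (univ.pi fun _ => Ioi (0 : ℝ))] 0) :
    ∀ᵐ t : Fin n → ℝ, (∀ i, 0 ≤ t i) → f t = 0 := by
  have hbox : ∀ m : ℕ, ∀ᵐ s ∂(volume.restrict (univ.pi fun _ : Fin n => Ioc (0 : ℝ) m)),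
      f s = 0 := by
    intro m
    have hsep := Separates.pi (n := n) (ν := fun _ => volume.restrict (Ioc (0 : ℝ) m))
      (fun _ => separates_ramp m) (fun _ q => by fun_prop)
      (fun _ q => ⟨(q : ℚ), fun s => by
        rw [Complex.norm_real, Real.norm_of_nonneg (le_max_right _ _)]
        exact max_le (by linarith [abs_nonneg s]) q.2.1.le⟩)
    rw [← restrict_pi_volume] at hsep
    have hz := hsep _ (integrableOn_exp_mul_box hf c fun _ => (m : ℝ)) fun q => ?_
    · filter_upwards [hz] with s hs
      exact (mul_eq_zero.1 hs).resolve_left (Complex.exp_ne_zero _)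
    · set t : Fin n → ℝ := fun i => ((q i : ℚ) : ℝ) with ht
      have h1 := integral_prod_mul_mLapPartial hf c (ψ := fun _ _ => 1)
        (fun _ => continuous_const) t
      have h0 : ∫ u in univ.pi fun i => Ioc 0 (t i),
          (∏ _i : Fin n, (1 : ℂ)) * mLapPartial n f c u = 0 := by
        refine integral_eq_zero_of_ae ?_
        filter_upwards [ae_restrict_of_ae_restrict_of_subset
          (Set.pi_mono fun i _ => Ioc_subset_Ioi_self) hG] with u hu
        simp [hu]
      rw [h0] at h1
      have hsub : (univ.pi fun i => Ioc 0 (t i)) ⊆ univ.pi fun _ : Fin n => Ioc (0 : ℝ) m :=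
        Set.pi_mono fun i _ => Ioc_subset_Ioc_right (q i).2.2
      rw [setIntegral_eq_of_subset_of_forall_sdiff_eq_zero
        (MeasurableSet.univ_pi fun _ => measurableSet_Ioc) hsub, h1]
      · refine setIntegral_congr_fun (MeasurableSet.univ_pi fun _ => measurableSet_Ioc)
          fun s hs => ?_
        rw [mul_comm]
        congr 1
        refine Finset.prod_congr rfl fun i _ => ?_
        have hi := hs i trivial
        rw [abs_of_pos hi.1]
        simp [ht]
      · intro s hs
        obtain ⟨i, hi⟩ : ∃ i, t i < s i := by
          by_contra! h
          exact hs.2 fun i _ => ⟨(hs.1 i trivial).1, h i⟩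
        beta_reduce
        rw [Finset.prod_eq_zero (Finset.mem_univ i), zero_mul]
        rw [abs_of_pos (hs.1 i trivial).1, max_eq_right (sub_nonpos.2 hi.le), Complex.ofReal_zero]
  have hO := (ae_restrict_iUnion_iff _ _).2 hbox
  rw [iUnion_natBox, ae_restrict_iff' (MeasurableSet.univ_pi fun _ => measurableSet_Ioi)] at hO
  have hne : ∀ᵐ t : Fin n → ℝ, ∀ i, t i ≠ 0 :=
    ae_all_iff.2 fun i => Measure.ae_eval_ne (fun _ : Fin n => (volume : Measure ℝ)) i 0
  filter_upwards [hO, hne] with t ht hne' h0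
  exact ht fun i _ => lt_of_le_of_ne (h0 i) (hne' i).symm

lemma isMUniquenessFamily_of_le_half {γ : Fin n → ℝ} (hγ : ∀ i, 0 < γ i)
    (hγ' : ∀ i, γ i ≤ 1 / 2) :
    IsMUniquenessFamily n (fun (k : Fin n → ℕ) j =>
      1 + Complex.I * (((((k j : ℝ) + 1) ^ (γ j) : ℝ)) : ℂ)) := by
  rintro f hf ⟨ω, -, hΩ, hω⟩ hz
  have hω1 : ∀ j, ω j < ((1 : ℝ) : EReal) := fun j => by simpa using hω 0 j
  choose c hωc hc1 using fun j => EReal.lt_iff_exists_real_btwn.1 (hω1 j)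
  simp only [EReal.coe_lt_coe_iff] at hc1
  have hmem : ∀ l : Fin n → ℂ, (∀ j, c j ≤ (l j).re) → l ∈ mOmegaB n f := fun l hl =>
    (hΩ fun j => (hωc j).trans_le (EReal.coe_le_coe_iff.2 (hl j))).1
  obtain ⟨C, hC⟩ := exists_bound_of_mem_mOmegaB (hmem (fun j => (c j : ℂ)) fun j => by simp)
  refine ae_eq_zero_of_mLapPartial_ae_eq_zero hf (c := fun j => (c j : ℂ)) ?_
  have hinteg := integrableOn_prod_exp_mul_of_bounded (μ := fun i => (((1 - c i) / 2 : ℝ) : ℂ))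
    (fun i => by rw [Complex.ofReal_re]; linarith [hc1 i])
    (aestronglyMeasurable_mLapPartial hf fun j => (c j : ℂ)) hC
  have hsep := Separates.pi (n := n) (ν := fun _ => volume.restrict (Ioi (0 : ℝ)))
    (fun i => separates_exp (y := fun k : ℕ => ((k : ℝ) + 1) ^ γ i) (δ := (1 - c i) / 2) (A := 1)
      (fun a b hab => by
        have := (Real.rpow_left_inj (by positivity) (by positivity) (hγ i).ne').1 hab
        exact_mod_cast add_right_cancel this)
      (by linarith [hc1 i])
      (fun k => by
        rw [abs_of_nonneg (by positivity), one_mul, Real.sqrt_eq_rpow]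
        exact Real.rpow_le_rpow_of_exponent_le (by linarith [k.cast_nonneg (α := ℝ)]) (hγ' i)))
    (fun i k => by fun_prop)
    (fun i k => ⟨1, fun u => by
      rw [norm_exp_neg_mul_ofReal, Real.exp_le_one_iff]
      have : 0 ≤ ((1 - c i) / 2) * |u| := mul_nonneg (by linarith [hc1 i]) (abs_nonneg u)
      simpa using this⟩)
  rw [← restrict_pi_volume] at hsep
  have h0 := hsep _ hinteg fun k => ?_
  · filter_upwards [h0] with u hu
    exact (mul_eq_zero.1 hu).resolve_left (Finset.prod_ne_zero_iff.2 fun i _ =>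
      Complex.exp_ne_zero _)
  · have hk := integral_exp_mul_mLapPartial_eq_zero hf (c := fun j => (c j : ℂ))
      (fun i => by simpa using hc1 i) (fun S => hmem _ fun j => ?_) (hz k)
    · rw [← hk]
      refine setIntegral_congr_fun (MeasurableSet.univ_pi fun _ => measurableSet_Ioi)
        fun u hu => ?_
      simp only
      rw [← mul_assoc, ← Finset.prod_mul_distrib]
      congr 1
      refine Finset.prod_congr rfl fun i _ => ?_
      rw [← Complex.exp_add, abs_of_pos (hu i trivial)]
      congr 1
      push_cast
      ring
    · split_ifs
      · simp
      · simpa using (hc1 j).le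

end Uniqueness

section Counterexample

lemma exists_ne_zero_forall_inner_eq_zero {H : Type*} [NormedAddCommGroup H]
    [InnerProductSpace ℂ H] [CompleteSpace H] {v : ℕ → H} {u : H} {f : ℕ → H} {B c : ℝ}
    (hc : 0 < c) (hB : ∀ M, ‖f M‖ ≤ B) (hv : ∀ k M, k < M → inner ℂ (v k) (f M) = 0)
    (hu : ∀ M, c ≤ ‖inner ℂ u (f M)‖) :
    ∃ g : H, g ≠ 0 ∧ ∀ k, inner ℂ (v k) g = 0 := by
  by_contra! hcon
  set K := Submodule.span ℂ (range v) with hK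
  have hbot : Kᗮ = ⊥ := by
    rw [Submodule.eq_bot_iff]
    intro g hg
    by_contra hne
    obtain ⟨k, hk⟩ := hcon g hne
    exact hk ((Submodule.mem_orthogonal K g).1 hg _ (Submodule.subset_span ⟨k, rfl⟩))
  have htop := Submodule.topologicalClosure_eq_top_iff.2 hbot
  have humem : u ∈ closure (K : Set H) := by
    rw [← Submodule.topologicalClosure_coe, htop]
    trivial
  have hB0 : 0 ≤ B := (norm_nonneg _).trans (hB 0)
  obtain ⟨w, hw, hd⟩ := Metric.mem_closure_iff.1 humem (c / (B + 1)) (by positivity)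
  have hev : ∀ᶠ M in atTop, inner ℂ w (f M) = 0 := by
    clear hd
    induction hw using Submodule.span_induction with
    | mem x hx =>
      obtain ⟨k, rfl⟩ := hx
      filter_upwards [eventually_gt_atTop k] with M hM using hv k M hM
    | zero => simp
    | add x y _ _ hx hy =>
      filter_upwards [hx, hy] with M h1 h2
      rw [inner_add_left, h1, h2, add_zero]
    | smul a x _ hx =>
      filter_upwards [hx] with M h1
      rw [inner_smul_left, h1, mul_zero]
  obtain ⟨M, hM⟩ := hev.exists
  have h1 : ‖inner ℂ u (f M)‖ ≤ c / (B + 1) * B := by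
    rw [← sub_zero (inner ℂ u (f M)), ← hM, ← inner_sub_left]
    refine (norm_inner_le_norm _ _).trans ?_
    rw [dist_eq_norm] at hd
    exact mul_le_mul hd.le (hB M) (norm_nonneg _) (by positivity)
  have h2 : c / (B + 1) * B < c := by
    rw [div_mul_eq_mul_div, div_lt_iff₀ (by positivity)]
    nlinarith
  linarith [hu M]

/-- Multiplying the Laplace transform by finitely many Blaschke factors. -/
lemma ExpDecay.exists_blaschke_prod {ε : ℝ} {h : ℝ → ℂ} (hh : ExpDecay ε h) (hε : 0 < ε)
    {a : ℕ → ℂ} (hre : ∀ k, ε < (a k).re) (N : ℕ) :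
    ∃ g, ExpDecay ε g ∧ ∫ t in Ioi (0 : ℝ), ‖g t‖ ^ 2 = ∫ t in Ioi (0 : ℝ), ‖h t‖ ^ 2 ∧
      ∀ μ : ℂ, 0 < μ.re →
        (∏ k ∈ Finset.range N, (μ + starRingEnd ℂ (a k))) * laplaceIoi g μ =
          (∏ k ∈ Finset.range N, (μ - a k)) * laplaceIoi h μ := by
  induction N with
  | zero => exact ⟨h, hh, rfl, by simp⟩
  | succ N ih =>
    obtain ⟨g, hg, hn, hL⟩ := ih
    obtain ⟨g', hg', hn', hL'⟩ := hg.exists_blaschke hε (b := -starRingEnd ℂ (a N))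
      (Or.inl (by simpa using hre N))
    refine ⟨g', hg', hn'.trans hn, fun μ hμ => ?_⟩
    have h1 := hL' μ hμ
    simp only [sub_neg_eq_add, map_neg, Complex.conj_conj, ← sub_eq_add_neg] at h1
    rw [Finset.prod_range_succ, Finset.prod_range_succ, mul_assoc, h1]
    linear_combination (μ - a N) * hL μ hμ

lemma expDecay_exp (a : ℂ) : ExpDecay a.re (fun t : ℝ => Complex.exp (-(a * t))) :=
  ⟨by fun_prop, 1, fun t _ => by rw [norm_exp_neg_mul_ofReal, one_mul]⟩

lemma ExpDecay.memLp {ε : ℝ} {h : ℝ → ℂ} (hh : ExpDecay ε h) (hε : 0 < ε) :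
    MemLp h 2 (volume.restrict (Ioi (0 : ℝ))) :=
  (memLp_two_iff_integrable_sq_norm hh.continuous.aestronglyMeasurable).2
    (hh.integrableOn_norm_sq hε)

lemma inner_exp_toLp {a : ℂ} (ha : 0 < a.re) {g : ℝ → ℂ}
    (hg : MemLp g 2 (volume.restrict (Ioi (0 : ℝ)))) :
    inner ℂ ((expDecay_exp (starRingEnd ℂ a)).memLp (by simpa using ha)).toLp hg.toLp =
      laplaceIoi g a := by
  rw [L2.inner_def, laplaceIoi]
  refine integral_congr_ae ?_
  filter_upwards [((expDecay_exp (starRingEnd ℂ a)).memLp (by simpa using ha)).coeFn_toLp,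
    hg.coeFn_toLp] with t h1 h2
  rw [h1, h2, RCLike.inner_apply, ← Complex.exp_conj, mul_comm]
  simp

lemma norm_sq_toLp {g : ℝ → ℂ} (hg : MemLp g 2 (volume.restrict (Ioi (0 : ℝ)))) :
    ‖hg.toLp‖ ^ 2 = ∫ t in Ioi (0 : ℝ), ‖g t‖ ^ 2 := by
  rw [← inner_self_eq_norm_sq (𝕜 := ℂ), L2.inner_def, ← integral_re (L2.integrable_inner _ _)]
  refine integral_congr_ae ?_
  filter_upwards [hg.coeFn_toLp] with t ht
  rw [ht, inner_self_eq_norm_sq]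

lemma exp_neg_mul_norm_le {y r : ℝ} (hr : 0 < r) (hy : r ≤ y ^ 2) :
    Real.exp (-(4 / r)) * ‖(2 : ℂ) + starRingEnd ℂ (1 + Complex.I * y)‖ ≤
      ‖(2 : ℂ) - (1 + Complex.I * y)‖ := by
  refine (sq_le_sq₀ (by positivity) (norm_nonneg _)).1 ?_
  have h1 : ‖(2 : ℂ) + starRingEnd ℂ (1 + Complex.I * y)‖ ^ 2 = 9 + y ^ 2 := by
    rw [← Complex.normSq_eq_norm_sq, Complex.normSq_apply]
    simp
    ring
  have h2 : ‖(2 : ℂ) - (1 + Complex.I * y)‖ ^ 2 = 1 + y ^ 2 := by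
    rw [← Complex.normSq_eq_norm_sq, Complex.normSq_apply]
    simp
    ring
  have h3 : 8 / r + 1 ≤ Real.exp (8 / r) := Real.add_one_le_exp _
  have h4 : Real.exp (-(4 / r)) ^ 2 = (Real.exp (8 / r))⁻¹ := by
    rw [← Real.exp_neg, ← Real.exp_nat_mul]
    congr 1
    push_cast
    ring
  rw [mul_pow, h1, h2, h4, inv_mul_le_iff₀ (Real.exp_pos _)]
  calc 9 + y ^ 2 ≤ (8 / r + 1) * (1 + y ^ 2) := by
        have : 8 ≤ 8 / r * y ^ 2 := by
          rw [div_mul_eq_mul_div, le_div_iff₀ hr]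
          linarith
        have : 0 ≤ 8 / r := by positivity
        linarith
    _ ≤ _ := by gcongr

/-- A nonzero function whose Laplace transform vanishes along `1 + i (k + 1) ^ γ`, `γ > 1 / 2`. -/
lemma exists_laplaceIoi_eq_zero {γ : ℝ} (hγ : 1 / 2 < γ) :
    ∃ p : ℝ → ℂ, (∀ μ : ℂ, 0 < μ.re →
        IntegrableOn (fun t : ℝ => Complex.exp (-(μ * t)) * p t) (Ioi 0)) ∧
      ¬ p =ᵐ[volume.restrict (Ioi (0 : ℝ))] 0 ∧
      ∀ k : ℕ, laplaceIoi p (1 + Complex.I * ((((k : ℝ) + 1) ^ γ : ℝ) : ℂ)) = 0 := by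
  set a : ℕ → ℂ := fun k => 1 + Complex.I * ((((k : ℝ) + 1) ^ γ : ℝ) : ℂ) with ha
  have hare : ∀ k, (a k).re = 1 := fun k => by simp [ha]
  have hf₀ : ExpDecay (1 / 2) (fun t : ℝ => Complex.exp (-((1 / 2 : ℂ) * t))) := by
    simpa using expDecay_exp (1 / 2)
  choose f hf hn hL using hf₀.exists_blaschke_prod (by norm_num) (a := a)
    (fun k => by rw [hare]; norm_num)
  have hL₀ : laplaceIoi (fun t : ℝ => Complex.exp (-((1 / 2 : ℂ) * t))) 2 ≠ 0 := by
    have h1 : ∀ t : ℝ, Complex.exp (-(2 * t)) * Complex.exp (-((1 / 2 : ℂ) * t)) =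
        Complex.exp ((-(5 / 2) : ℂ) * t) := fun t => by
      rw [← Complex.exp_add]; congr 1; ring
    simp only [laplaceIoi, h1]
    rw [integral_exp_mul_complex_Ioi (by norm_num)]
    norm_num
  have hsum : Summable fun k : ℕ => 4 / ((k : ℝ) + 1) ^ (2 * γ) := by
    have h1 := (summable_nat_add_iff 1).2 (Real.summable_one_div_nat_rpow.2
      (show 1 < 2 * γ by linarith))
    simpa [div_eq_mul_inv] using h1.mul_left 4
  have hlow : ∀ N, Real.exp (-∑' k : ℕ, 4 / ((k : ℝ) + 1) ^ (2 * γ)) *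
      ‖laplaceIoi (fun t : ℝ => Complex.exp (-((1 / 2 : ℂ) * t))) 2‖ ≤ ‖laplaceIoi (f N) 2‖ := by
    intro N
    have hpos : 0 < ∏ k ∈ Finset.range N, ‖(2 : ℂ) + starRingEnd ℂ (a k)‖ := by
      refine Finset.prod_pos fun k _ => norm_pos_iff.2 fun h => ?_
      have := congrArg Complex.re h
      simp [hare] at this
      norm_num at this
    have h1 : Real.exp (-∑' k : ℕ, 4 / ((k : ℝ) + 1) ^ (2 * γ)) *
        ∏ k ∈ Finset.range N, ‖(2 : ℂ) + starRingEnd ℂ (a k)‖ ≤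
          ∏ k ∈ Finset.range N, ‖(2 : ℂ) - a k‖ := by
      calc _ ≤ Real.exp (∑ k ∈ Finset.range N, -(4 / ((k : ℝ) + 1) ^ (2 * γ))) *
            ∏ k ∈ Finset.range N, ‖(2 : ℂ) + starRingEnd ℂ (a k)‖ := by
            gcongr
            rw [Finset.sum_neg_distrib]
            exact neg_le_neg (hsum.sum_le_tsum _ fun k _ => by positivity)
        _ = ∏ k ∈ Finset.range N, Real.exp (-(4 / ((k : ℝ) + 1) ^ (2 * γ))) *
              ‖(2 : ℂ) + starRingEnd ℂ (a k)‖ := by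
            rw [Real.exp_sum, Finset.prod_mul_distrib]
        _ ≤ _ := Finset.prod_le_prod (fun k _ => by positivity) fun k _ =>
            exp_neg_mul_norm_le (by positivity) (by
              rw [mul_comm 2 γ, Real.rpow_mul (by positivity)]
              norm_cast)
    have h2 := congrArg norm (hL N 2 (by norm_num))
    rw [norm_mul, norm_mul, norm_prod, norm_prod] at h2
    refine le_of_mul_le_mul_left ?_ hpos
    rw [h2, ← mul_assoc, mul_comm (∏ k ∈ Finset.range N, _)]
    gcongr
  have hmem := fun N => (hf N).memLp (by norm_num : (0 : ℝ) < 1 / 2)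
  obtain ⟨g, hg0, hg⟩ := exists_ne_zero_forall_inner_eq_zero
    (v := fun k => ((expDecay_exp (starRingEnd ℂ (a k))).memLp (by simp [hare])).toLp)
    (u := ((expDecay_exp (starRingEnd ℂ 2)).memLp (by simp)).toLp)
    (f := fun N => (hmem N).toLp) (B := ‖(hf₀.memLp (by norm_num)).toLp‖)
    (mul_pos (Real.exp_pos _) (norm_pos_iff.2 hL₀))
    (fun N => by
      refine (sq_le_sq₀ (by positivity) (norm_nonneg _)).1 ?_
      rw [norm_sq_toLp, norm_sq_toLp, hn])
    (fun k N hkN => by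
      rw [inner_exp_toLp (by simp [hare])]
      have h1 := hL N (a k) (by simp [hare])
      rw [Finset.prod_eq_zero (f := fun j => a k - a j) (Finset.mem_range.2 hkN)
        (sub_self (a k)), zero_mul] at h1
      refine (mul_eq_zero.1 h1).resolve_left (Finset.prod_ne_zero_iff.2 fun j _ h => ?_)
      have := congrArg Complex.re h
      simp [hare] at this)
    (fun N => by
      rw [inner_exp_toLp (by simp)]
      exact hlow N)
  refine ⟨g, fun μ hμ => ?_, fun h => hg0 ((Lp.eq_zero_iff_ae_eq_zero).2 h), fun k => ?_⟩
  · exact ((expDecay_exp μ).memLp hμ).integrable_mul (Lp.memLp g)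
  · have h1 := inner_exp_toLp (a := a k) (by simp [hare]) (Lp.memLp g)
    rw [Lp.toLp_coeFn] at h1
    rw [← h1]
    exact hg k

variable {n : ℕ} {p : ℝ → ℂ}

lemma mLapPartial_prod (p : ℝ → ℂ) (l : Fin n → ℂ) (t : Fin n → ℝ) :
    mLapPartial n (fun s => ∏ i, p (s i)) l t =
      ∏ i, ∫ s in Ioc (0 : ℝ) (t i), Complex.exp (-(l i * s)) * p s := by
  rw [mLapPartial, restrict_pi_volume, ← integral_fintype_prod_eq_prod]
  refine integral_congr_ae (Eventually.of_forall fun s => ?_)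
  beta_reduce
  rw [← Finset.sum_neg_distrib, Complex.exp_sum, Finset.prod_mul_distrib]

lemma hasMLaplace_prod {l : Fin n → ℂ}
    (hp : ∀ i, IntegrableOn (fun t : ℝ => Complex.exp (-(l i * t)) * p t) (Ioi 0)) :
    HasMLaplace n (fun s => ∏ i, p (s i)) l (∏ i, laplaceIoi p (l i)) := by
  refine Tendsto.congr (fun t => (mLapPartial_prod p l t).symm) ?_
  refine tendsto_finsetProd _ fun i _ => ?_
  have hev : Tendsto (fun t : Fin n → ℝ => t i) atTop atTop :=
    tendsto_atTop.2 fun b => (eventually_ge_atTop fun _ => b).mono fun t h => h i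
  refine ((intervalIntegral_tendsto_integral_Ioi 0 (hp i) tendsto_id).comp hev).congr' ?_
  filter_upwards [hev.eventually_ge_atTop 0] with t ht
  exact intervalIntegral.integral_of_le ht

lemma mem_mOmegaB_prod {l : Fin n → ℂ}
    (hp : ∀ i, IntegrableOn (fun t : ℝ => Complex.exp (-(l i * t)) * p t) (Ioi 0)) :
    l ∈ mOmegaB n (fun s => ∏ i, p (s i)) := by
  change Bornology.IsBounded (mLapPartial n _ l '' _)
  refine isBounded_iff_forall_norm_le.2
    ⟨∏ i, ∫ t in Ioi (0 : ℝ), ‖Complex.exp (-(l i * t)) * p t‖, ?_⟩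
  rintro _ ⟨t, -, rfl⟩
  rw [mLapPartial_prod, norm_prod]
  refine Finset.prod_le_prod (fun _ _ => norm_nonneg _) fun i _ => ?_
  exact (norm_integral_le_integral_norm _).trans
    (setIntegral_mono_set (hp i).norm (Eventually.of_forall fun _ => norm_nonneg _)
      Ioc_subset_Ioi_self.eventuallyLE)

lemma prod_exp_mul (p : ℝ → ℂ) (t : Fin n → ℝ) :
    Complex.exp (∑ i, (t i : ℂ)) * ∏ i, Complex.exp (-(1 * (t i : ℂ))) * p (t i) =
      ∏ i, p (t i) := by
  rw [Complex.exp_sum, ← Finset.prod_mul_distrib]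
  refine Finset.prod_congr rfl fun i _ => ?_
  rw [← mul_assoc, ← Complex.exp_add]
  simp

lemma locallyIntegrableOn_prod
    (hp : IntegrableOn (fun t : ℝ => Complex.exp (-(1 * t)) * p t) (Ioi 0)) :
    LocallyIntegrableOn (fun s : Fin n → ℝ => ∏ i, p (s i)) {t | ∀ i, 0 ≤ t i} := by
  have hset : {t : Fin n → ℝ | ∀ i, 0 ≤ t i} = Ici 0 := rfl
  have h1 : IntegrableOn (fun s : Fin n → ℝ => ∏ i, Complex.exp (-(1 * (s i : ℂ))) * p (s i))
      {t | ∀ i, 0 ≤ t i} := by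
    rw [hset, IntegrableOn, volume_pi, ← Measure.restrict_congr_set
      Measure.univ_pi_Ioi_ae_eq_Ici, ← volume_pi, restrict_pi_volume]
    exact Integrable.fintype_prod (f := fun _ (t : ℝ) => Complex.exp (-(1 * (t : ℂ))) * p t)
      fun _ => hp
  have hc : Continuous fun s : Fin n → ℝ => Complex.exp (∑ i, (s i : ℂ)) := by fun_prop
  have h2 := h1.locallyIntegrableOn.continuousOn_mul hc.continuousOn
    (hset ▸ isClosed_Ici.isLocallyClosed)
  simpa only [prod_exp_mul] using h2

lemma not_ae_eq_zero_prod
    (hp : IntegrableOn (fun t : ℝ => Complex.exp (-(1 * t)) * p t) (Ioi 0))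
    (hp0 : ¬ p =ᵐ[volume.restrict (Ioi (0 : ℝ))] 0) :
    ¬ ∀ᵐ t : Fin n → ℝ, (∀ i, 0 ≤ t i) → ∏ i, p (t i) = 0 := by
  intro h
  have h1 : ∫ s in univ.pi fun _ : Fin n => Ioi (0 : ℝ),
      ∏ i, ‖Complex.exp (-(1 * (s i : ℂ))) * p (s i)‖ = 0 := by
    refine integral_eq_zero_of_ae ?_
    filter_upwards [ae_restrict_of_ae h, ae_restrict_mem
      (MeasurableSet.univ_pi fun _ : Fin n => measurableSet_Ioi)] with s hs hs'
    have := hs fun i => (hs' i trivial).le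
    rw [← norm_prod, Finset.prod_mul_distrib, this]
    simp
  rw [restrict_pi_volume, integral_fintype_prod_eq_prod
    (f := fun _ (t : ℝ) => ‖Complex.exp (-(1 * (t : ℂ))) * p t‖), Finset.prod_eq_zero_iff] at h1
  obtain ⟨i, -, hi⟩ := h1
  rw [integral_eq_zero_iff_of_nonneg (fun _ => norm_nonneg _) hp.norm] at hi
  refine hp0 ?_
  filter_upwards [hi] with t ht
  exact (mul_eq_zero.1 (norm_eq_zero.1 ht)).resolve_left (Complex.exp_ne_zero _)

lemma not_isMUniquenessFamily_of_half_lt {γ : Fin n → ℝ} {i : Fin n} (hi : 1 / 2 < γ i) :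
    ¬ IsMUniquenessFamily n (fun (k : Fin n → ℕ) j =>
      1 + Complex.I * (((((k j : ℝ) + 1) ^ (γ j) : ℝ)) : ℂ)) := by
  obtain ⟨p, hp, hp0, hz⟩ := exists_laplaceIoi_eq_zero hi
  intro h
  refine not_ae_eq_zero_prod (n := n) (hp 1 (by simp)) hp0
    (h _ (locallyIntegrableOn_prod (hp 1 (by simp))) ⟨fun _ => 0, fun _ => EReal.zero_ne_top,
      fun l hl => ?_, fun k j => by simp⟩ fun k => ?_)
  · have hl' : ∀ j, 0 < (l j).re := fun j => EReal.coe_pos.1 (hl j)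
    exact ⟨mem_mOmegaB_prod fun j => hp _ (hl' j), _, hasMLaplace_prod fun j => hp _ (hl' j)⟩
  · have h1 := hasMLaplace_prod (n := n) (p := p)
      (l := fun j => 1 + Complex.I * (((((k j : ℝ) + 1) ^ (γ j) : ℝ)) : ℂ))
      fun j => hp _ (by simp)
    rwa [Finset.prod_eq_zero (Finset.mem_univ i) (hz (k i))] at h1

end Counterexample

theorem stmt11 (n : ℕ) (γ : Fin n → ℝ) (hγ : ∀ i, 0 < γ i) :
    IsMUniquenessFamily n
      (fun (k : Fin n → ℕ) j =>
        1 + Complex.I * (((((k j : ℝ) + 1) ^ (γ j) : ℝ)) : ℂ)) ↔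
      ∀ i, γ i ≤ 1 / 2 :=
  ⟨fun h _ => not_lt.1 fun hi => not_isMUniquenessFamily_of_half_lt hi h,
    isMUniquenessFamily_of_le_half hγ⟩

end
end

section
/- For every θ ∈ (0, π/2), the countable family of points {(k_1,k_2) ∈ ℕ^2 : arg(k_1 + i·k_2) ≤ θ} (where arg denotes the principal argument and i the imaginary unit), regarded as a family in ℂ^2 via the inclusion ℕ^2 ⊆ ℂ^2, is a uniqueness sequence for the 2-dimensional Laplace transform. -/
open MeasureTheory Filter Set

noncomputable section

open scoped BoundedContinuousFunction in
theorem ae_eq_zero_of_forall_integral_monomial_eq_zero {E : Type*} [TopologicalSpace E]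
    [PolishSpace E] [MeasurableSpace E] [BorelSpace E] {ν : Measure E} (x u : E →ᵇ ℝ)
    (hinj : Function.Injective fun e => (x e, u e)) {h : E → ℝ} (hh : Integrable h ν)
    (h0 : ∀ i p : ℕ, ∫ e, x e ^ i * u e ^ p * h e ∂ν = 0) : h =ᵐ[ν] 0 := by
  let A : StarSubalgebra ℝ (E →ᵇ ℝ) :=
    { Algebra.adjoin ℝ {x, u} with
      star_mem' := fun {a} ha => by
        have : star a = a := by ext; simp
        rwa [this] }
  have hbdd (v : E →ᵇ ℝ) : Integrable (fun e => v e * h e) ν :=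
    hh.bdd_mul (c := ‖v‖) v.continuous.aestronglyMeasurable
      (Eventually.of_forall fun e => v.norm_coe_le_norm e)
  have hzero : ∀ v ∈ A, ∫ e, v e * h e ∂ν = 0 := by
    intro v hv
    have hv' : v ∈ Submodule.span ℝ (Submonoid.closure ({x, u} : Set (E →ᵇ ℝ)) : Set (E →ᵇ ℝ)) := by
      rw [← Algebra.adjoin_eq_span]
      exact hv
    induction hv' using Submodule.span_induction with
    | mem a ha =>
      obtain ⟨i, p, rfl⟩ := (Submonoid.mem_closure_pair x u a).1 ha
      simpa using h0 i p
    | zero => simp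
    | add a b ha hb iha ihb =>
      have ha' : a ∈ A := by rwa [← Algebra.adjoin_eq_span] at ha
      have hb' : b ∈ A := by rwa [← Algebra.adjoin_eq_span] at hb
      simp only [BoundedContinuousFunction.coe_add, Pi.add_apply, add_mul]
      rw [integral_add (hbdd a) (hbdd b), iha ha', ihb hb', add_zero]
    | smul c a ha iha =>
      have ha' : a ∈ A := by rwa [← Algebra.adjoin_eq_span] at ha
      simp only [BoundedContinuousFunction.coe_smul, smul_eq_mul, mul_assoc]
      rw [integral_const_mul, iha ha', mul_zero]
  have hpos : Integrable (fun e => max (h e) 0) ν := hh.pos_part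
  have hneg : Integrable (fun e => max (-h e) 0) ν := hh.neg_part
  have := isFiniteMeasure_withDensity_ofReal hpos.2
  have := isFiniteMeasure_withDensity_ofReal hneg.2
  have key : ν.withDensity (fun e => ENNReal.ofReal (max (h e) 0)) =
      ν.withDensity (fun e => ENNReal.ofReal (max (-h e) 0)) := by
    refine ext_of_forall_mem_subalgebra_integral_eq_of_polish (𝕜 := ℝ) (A := A) ?_ ?_
    · intro a b hab
      have hx : x ∈ A := Algebra.subset_adjoin (by simp)
      have hu : u ∈ A := Algebra.subset_adjoin (by simp)
      by_cases hxab : x a = x b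
      · refine ⟨u, ⟨_, ⟨u, hu, rfl⟩, rfl⟩, fun huab => hab (hinj (Prod.ext hxab huab))⟩
      · exact ⟨x, ⟨_, ⟨x, hx, rfl⟩, rfl⟩, hxab⟩
    · intro v hv
      rw [integral_withDensity_eq_integral_toReal_smul₀ hpos.aemeasurable.ennreal_ofReal
          (by simp),
        integral_withDensity_eq_integral_toReal_smul₀ hneg.aemeasurable.ennreal_ofReal
          (by simp), ← sub_eq_zero]
      have e1 (e : E) : (ENNReal.ofReal (max (h e) 0)).toReal = max (h e) 0 :=
        ENNReal.toReal_ofReal (le_max_right _ _)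
      have e2 (e : E) : (ENNReal.ofReal (max (-h e) 0)).toReal = max (-h e) 0 :=
        ENNReal.toReal_ofReal (le_max_right _ _)
      have hv1 : Integrable (fun e => max (h e) 0 * v e) ν :=
        hpos.mul_bdd (c := ‖v‖) v.continuous.aestronglyMeasurable
          (Eventually.of_forall fun e => v.norm_coe_le_norm e)
      have hv2 : Integrable (fun e => max (-h e) 0 * v e) ν :=
        hneg.mul_bdd (c := ‖v‖) v.continuous.aestronglyMeasurable
          (Eventually.of_forall fun e => v.norm_coe_le_norm e)
      simp only [e1, e2, smul_eq_mul]
      rw [← integral_sub hv1 hv2]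
      refine (integral_congr_ae (Eventually.of_forall fun e => ?_)).trans (hzero v hv)
      rcases le_total 0 (h e) with h' | h' <;> simp [h', mul_comm]
  rw [withDensity_eq_iff hpos.aemeasurable.ennreal_ofReal hneg.aemeasurable.ennreal_ofReal] at key
  · filter_upwards [key] with e he
    rw [ENNReal.ofReal_eq_ofReal_iff (by simp) (by simp)] at he
    rcases le_total 0 (h e) with h' | h' <;> simp_all
  · exact hpos.lintegral_lt_top.ne

/-- The open orthant `(0,∞)ⁿ`. -/
def orthant (n : ℕ) : Set (Fin n → ℝ) := Set.pi univ fun _ => Ioi 0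

theorem mem_orthant {n : ℕ} {t : Fin n → ℝ} : t ∈ orthant n ↔ ∀ i, 0 < t i := by
  simp [orthant]

theorem isOpen_orthant (n : ℕ) : IsOpen (orthant n) :=
  isOpen_set_pi finite_univ fun _ _ => isOpen_Ioi

/-- The exponential weight `exp (-⟨z, t⟩)`. -/
def expWeight {n : ℕ} (z t : Fin n → ℝ) : ℝ := Real.exp (-∑ i, z i * t i)

theorem expWeight_pos {n : ℕ} (z t : Fin n → ℝ) : 0 < expWeight z t := Real.exp_pos _

theorem continuous_expWeight {n : ℕ} (z : Fin n → ℝ) : Continuous (expWeight z) := by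
  unfold expWeight; fun_prop

theorem expWeight_add {n : ℕ} (z w t : Fin n → ℝ) :
    expWeight (z + w) t = expWeight z t * expWeight w t := by
  simp only [expWeight, ← Real.exp_add, Pi.add_apply, add_mul, Finset.sum_add_distrib, neg_add]

theorem expWeight_le_one {n : ℕ} {z t : Fin n → ℝ} (hz : ∀ i, 0 ≤ z i) (ht : t ∈ orthant n) :
    expWeight z t ≤ 1 :=
  Real.exp_le_one_iff.2 <| neg_nonpos.2 <|
    Finset.sum_nonneg fun i _ => mul_nonneg (hz i) (mem_orthant.1 ht i).le

theorem expWeight_eq_prod {n : ℕ} (z t : Fin n → ℝ) :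
    expWeight z t = ∏ i, Real.exp (-z i * t i) := by
  simp [expWeight, ← Real.exp_sum, Finset.sum_neg_distrib]

theorem integrableOn_expWeight_orthant {n : ℕ} {z : Fin n → ℝ} (hz : ∀ i, 0 < z i) :
    IntegrableOn (expWeight z) (orthant n) := by
  rw [IntegrableOn, orthant, volume_pi, Measure.restrict_pi_pi,
    funext (expWeight_eq_prod z)]
  exact Integrable.fintype_prod (f := fun i s => Real.exp (-z i * s)) fun i =>
    integrableOn_exp_mul_Ioi (neg_neg_of_pos (hz i)) 0

theorem integral_expWeight_Ici {n : ℕ} {z : Fin n → ℝ} (hz : ∀ i, 0 < z i) (s : Fin n → ℝ) :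
    ∫ t in Ici s, expWeight z t = (∏ i, z i)⁻¹ * expWeight z s := by
  rw [← pi_univ_Ici, volume_pi, Measure.restrict_pi_pi, funext (expWeight_eq_prod z),
    integral_fintype_prod_eq_prod (fun i s => Real.exp (-z i * s)), ← Finset.prod_inv_distrib,
    ← Finset.prod_mul_distrib]
  refine Finset.prod_congr rfl fun i _ => ?_
  rw [integral_Ici_eq_integral_Ioi, integral_exp_mul_Ioi (neg_neg_of_pos (hz i))]
  field_simp

/-- Integration by parts without boundary terms. -/
theorem setIntegral_Iic_expWeight_smul {n : ℕ} {z : Fin n → ℝ} (hz : ∀ i, 0 < z i)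
    {F : (Fin n → ℝ) → ℂ} {T : Fin n → ℝ}
    (hF : IntegrableOn F (Iic T) (volume.restrict (orthant n))) :
    ∫ s in Iic T, expWeight z s • F s ∂(volume.restrict (orthant n)) =
      (∏ i, z i) • ∫ t in orthant n,
        expWeight z t • ∫ s in Iic (t ⊓ T), F s ∂(volume.restrict (orthant n)) := by
  set μ := (volume : Measure (Fin n → ℝ)).restrict (orthant n) with hμ
  have hkey : ∫ s in Iic T, (∫ t in Ici s, expWeight z t ∂μ) • F s ∂μ =
      ∫ t, expWeight z t • (∫ s in Iic (t ⊓ T), F s ∂μ) ∂μ := by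
    have hint : Integrable (Function.uncurry fun s t : Fin n → ℝ =>
        {p : (Fin n → ℝ) × (Fin n → ℝ) | p.1 ≤ p.2}.indicator
          (fun p => expWeight z p.2 • F p.1) (s, t)) ((μ.restrict (Iic T)).prod μ) := by
      refine Integrable.indicator ?_ (measurableSet_le measurable_fst measurable_snd)
      simpa [mul_comm] using hF.mul_prod (integrableOn_expWeight_orthant hz).ofReal
    have hs (s : Fin n → ℝ) : (∫ t in Ici s, expWeight z t ∂μ) • F s =
        ∫ t, {p : (Fin n → ℝ) × (Fin n → ℝ) | p.1 ≤ p.2}.indicator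
          (fun p => expWeight z p.2 • F p.1) (s, t) ∂μ := by
      rw [← integral_smul_const, ← integral_indicator measurableSet_Ici]
      rfl
    have ht (t : Fin n → ℝ) : expWeight z t • (∫ s in Iic (t ⊓ T), F s ∂μ) =
        ∫ s in Iic T, {p : (Fin n → ℝ) × (Fin n → ℝ) | p.1 ≤ p.2}.indicator
          (fun p => expWeight z p.2 • F p.1) (s, t) ∂μ := by
      rw [← integral_smul, inf_comm, ← Iic_inter_Iic, ← setIntegral_indicator measurableSet_Iic]
      rfl
    simp only [hs, ht]
    exact integral_integral_swap hint
  have hL : ∫ s in Iic T, (∫ t in Ici s, expWeight z t ∂μ) • F s ∂μ =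
      (∏ i, z i)⁻¹ • ∫ s in Iic T, expWeight z s • F s ∂μ := by
    rw [← integral_smul]
    refine integral_congr_ae ?_
    filter_upwards [ae_restrict_of_ae (ae_restrict_mem (isOpen_orthant n).measurableSet)]
      with s hs
    have hsub : Ici s ⊆ orthant n := fun t ht =>
      mem_orthant.2 fun i => (mem_orthant.1 hs i).trans_le (ht i)
    rw [hμ, Measure.restrict_restrict measurableSet_Ici, inter_eq_left.2 hsub,
      integral_expWeight_Ici hz, smul_smul]
  rw [← hkey, hL, smul_smul, mul_inv_cancel₀ (Finset.prod_pos fun i _ => hz i).ne', one_smul]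

theorem expWeight_cone (N : ℕ) (i p : ℕ) (t : Fin 2 → ℝ) :
    expWeight ![(N * p + i : ℝ), p] t =
      expWeight ![(1 : ℝ), 0] t ^ i * expWeight ![(N : ℝ), 1] t ^ p := by
  simp only [expWeight, ← Real.exp_nat_mul, ← Real.exp_add, Fin.sum_univ_two]
  congr 1
  simp
  ring

open scoped BoundedContinuousFunction in
/-- The weight `expWeight z` as a bounded continuous function on the open orthant. -/
def expWeightBCF {n : ℕ} (z : Fin n → ℝ) (hz : ∀ i, 0 ≤ z i) : orthant n →ᵇ ℝ :=
  BoundedContinuousFunction.ofNormedAddCommGroup (fun t => expWeight z t)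
    ((continuous_expWeight z).comp continuous_subtype_val) 1 fun t => by
      rw [Real.norm_of_nonneg (expWeight_pos z t).le]
      exact expWeight_le_one hz t.2

theorem ae_eq_zero_of_forall_integral_cone_real (N : ℕ) {h : (Fin 2 → ℝ) → ℝ}
    (hh : IntegrableOn h (orthant 2))
    (h0 : ∀ i p : ℕ, ∫ t in orthant 2, expWeight ![(N * p + i : ℝ), p] t * h t = 0) :
    h =ᵐ[volume.restrict (orthant 2)] 0 := by
  have hS := (isOpen_orthant 2).measurableSet
  have hemb := MeasurableEmbedding.subtype_coe hS
  have := (isOpen_orthant 2).polishSpace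
  rw [← map_comap_subtype_coe hS] at h0 ⊢
  rw [IntegrableOn, ← map_comap_subtype_coe hS, hemb.integrable_map_iff] at hh
  simp only [hemb.integral_map] at h0
  refine hemb.ae_map_iff.2 (ae_eq_zero_of_forall_integral_monomial_eq_zero
    (expWeightBCF ![(1 : ℝ), 0] (by simp [Fin.forall_fin_two]))
    (expWeightBCF ![(N : ℝ), 1] (by simp [Fin.forall_fin_two])) ?_ hh fun i p => ?_)
  · intro a b hab
    simp only [expWeightBCF, BoundedContinuousFunction.coe_ofNormedAddCommGroup, Prod.mk.injEq,
      expWeight, Real.exp_eq_exp, Fin.sum_univ_two, neg_inj, Matrix.cons_val_zero,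
      Matrix.cons_val_one, one_mul, zero_mul, add_zero] at hab
    obtain ⟨h1, h2⟩ := hab
    rw [h1, add_right_inj] at h2
    ext i
    fin_cases i
    · exact h1
    · exact h2
  · simp only [expWeight_cone] at h0
    exact h0 i p

theorem ae_eq_zero_of_forall_integral_cone (N : ℕ) {h : (Fin 2 → ℝ) → ℂ}
    (hh : IntegrableOn h (orthant 2))
    (h0 : ∀ i p : ℕ, ∫ t in orthant 2, expWeight ![(N * p + i : ℝ), p] t • h t = 0) :
    h =ᵐ[volume.restrict (orthant 2)] 0 := by
  have hint (i p : ℕ) :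
      IntegrableOn (fun t => expWeight ![(N * p + i : ℝ), p] t • h t) (orthant 2) := by
    refine Integrable.bdd_smul hh 1 (continuous_expWeight _).aestronglyMeasurable ?_
    filter_upwards [ae_restrict_mem (isOpen_orthant 2).measurableSet] with t ht
    rw [Real.norm_of_nonneg (expWeight_pos _ t).le]
    exact expWeight_le_one (by simp [Fin.forall_fin_two]; positivity) ht
  have hre := ae_eq_zero_of_forall_integral_cone_real N hh.re fun i p => by
    have := integral_re (hint i p)
    rw [h0] at this
    simpa using this
  have him := ae_eq_zero_of_forall_integral_cone_real N hh.im fun i p => by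
    have := integral_im (hint i p)
    rw [h0] at this
    simpa using this
  filter_upwards [hre, him] with t h1 h2
  exact Complex.ext h1 h2

/-- The primitive of `F` over the boxes of the open orthant. -/
def boxIntegral {n : ℕ} (F : (Fin n → ℝ) → ℂ) (t : Fin n → ℝ) : ℂ :=
  ∫ s in Iic t, F s ∂(volume.restrict (orthant n))

theorem aestronglyMeasurable_boxIntegral {n : ℕ} {F : (Fin n → ℝ) → ℂ}
    (hF : AEStronglyMeasurable F (volume.restrict (orthant n))) :
    AEStronglyMeasurable (boxIntegral F) (volume.restrict (orthant n)) := by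
  have h : AEStronglyMeasurable
      ({p : (Fin n → ℝ) × (Fin n → ℝ) | p.2 ≤ p.1}.indicator fun p => F p.2)
      ((volume.restrict (orthant n)).prod (volume.restrict (orthant n))) :=
    hF.comp_snd.indicator (measurableSet_le measurable_snd measurable_fst)
  refine h.integral_prod_right'.congr (Eventually.of_forall fun t => ?_)
  simp only [boxIntegral, ← integral_indicator measurableSet_Iic]
  rfl

theorem boxIntegral_indicator {n : ℕ} (F : (Fin n → ℝ) → ℂ) (t T : Fin n → ℝ) :
    boxIntegral ((Iic T).indicator F) t = boxIntegral F (t ⊓ T) := by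
  rw [boxIntegral, setIntegral_indicator measurableSet_Iic, Iic_inter_Iic, boxIntegral]

/-- If the Laplace integral of `F` at `z` converges to zero and the primitive of `F` is bounded,
then the Laplace transform of the primitive vanishes at `z`. -/
theorem integral_expWeight_smul_boxIntegral_eq_zero {n : ℕ} {z : Fin n → ℝ} (hz : ∀ i, 0 < z i)
    {F : (Fin n → ℝ) → ℂ} (hm : AEStronglyMeasurable F (volume.restrict (orthant n)))
    (hF : ∀ T, IntegrableOn F (Iic T) (volume.restrict (orthant n)))
    {C : ℝ} (hC : ∀ t ∈ orthant n, ‖boxIntegral F t‖ ≤ C)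
    (h0 : Tendsto (boxIntegral fun s => expWeight z s • F s) atTop (nhds 0)) :
    ∫ t in orthant n, expWeight z t • boxIntegral F t = 0 := by
  let T : ℕ → Fin n → ℝ := fun k _ => k + 1
  have hT : Tendsto T atTop atTop :=
    tendsto_atTop.2 fun b => by
      filter_upwards [eventually_all.2 fun i => tendsto_natCast_atTop_atTop.eventually_ge_atTop (b i)]
        with k hk i
      exact (hk i).trans (le_add_of_nonneg_right zero_le_one)
  have hTpos (k : ℕ) (t : Fin n → ℝ) (ht : t ∈ orthant n) : t ⊓ T k ∈ orthant n :=
    mem_orthant.2 fun i => lt_inf_iff.2 ⟨mem_orthant.1 ht i, by positivity⟩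
  have hlim : Tendsto (fun k => ∫ t in orthant n, expWeight z t • boxIntegral F (t ⊓ T k)) atTop
      (nhds (∫ t in orthant n, expWeight z t • boxIntegral F t)) := by
    refine tendsto_integral_of_dominated_convergence (fun t => expWeight z t * C)
      (fun k => ?_) ((integrableOn_expWeight_orthant hz).mul_const C) (fun k => ?_) ?_
    · simp only [← boxIntegral_indicator]
      exact (continuous_expWeight z).aestronglyMeasurable.smul
        (aestronglyMeasurable_boxIntegral (hm.indicator measurableSet_Iic))
    · filter_upwards [ae_restrict_mem (isOpen_orthant n).measurableSet] with t ht
      rw [norm_smul, Real.norm_of_nonneg (expWeight_pos z t).le]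
      exact mul_le_mul_of_nonneg_left (hC _ (hTpos k t ht)) (expWeight_pos z t).le
    · refine Eventually.of_forall fun t => tendsto_const_nhds.congr' ?_
      filter_upwards [hT.eventually_ge_atTop t] with k hk
      rw [inf_eq_left.2 hk]
  have hlim' := (hlim.const_smul (∏ i, z i)).congr fun k =>
    (setIntegral_Iic_expWeight_smul hz (hF (T k))).symm
  exact (smul_eq_zero.1 (tendsto_nhds_unique hlim' (h0.comp hT))).resolve_left
    (Finset.prod_pos fun i _ => hz i).ne'

theorem boxIntegral_eq_zero_of_ae {n : ℕ} {F : (Fin n → ℝ) → ℂ}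
    (hF : ∀ T, IntegrableOn F (Iic T) (volume.restrict (orthant n)))
    (h : boxIntegral F =ᵐ[volume.restrict (orthant n)] 0) {t : Fin n → ℝ} (ht : t ∈ orthant n) :
    boxIntegral F t = 0 := by
  have hex (k : ℕ) : ∃ t' : Fin n → ℝ,
      t ≤ t' ∧ (∀ i, t' i ≤ t i + 1 / ((k : ℝ) + 1)) ∧ boxIntegral F t' = 0 := by
    let U : Set (Fin n → ℝ) := Set.pi univ fun i => Ioo (t i) (t i + 1 / ((k : ℝ) + 1))
    have hU : IsOpen U := isOpen_set_pi finite_univ fun _ _ => isOpen_Ioo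
    have hne : U.Nonempty := univ_pi_nonempty_iff.2 fun i =>
      nonempty_Ioo.2 (lt_add_of_pos_right _ Nat.one_div_pos_of_nat)
    have hsub : U ⊆ orthant n := fun s hs =>
      mem_orthant.2 fun i => (mem_orthant.1 ht i).trans (hs i (mem_univ i)).1
    have hne' : (ae (volume.restrict U)).NeBot := by
      rw [ae_neBot, Ne, Measure.restrict_eq_zero]
      exact (hU.measure_pos volume hne).ne'
    obtain ⟨s, hs, hs'⟩ := ((ae_restrict_mem hU.measurableSet).and
      (ae_restrict_of_ae_restrict_of_subset hsub h)).exists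
    exact ⟨s, fun i => (hs i (mem_univ i)).1.le, fun i => (hs i (mem_univ i)).2.le, hs'⟩
  choose s hts hst hs0 using hex
  have hlim : Tendsto (fun k => boxIntegral F (s k)) atTop (nhds (boxIntegral F t)) := by
    simp only [boxIntegral, ← integral_indicator measurableSet_Iic]
    refine tendsto_integral_of_dominated_convergence
      (fun x => ‖(Iic (fun i => t i + 1)).indicator F x‖) (fun k => ?_) ?_ (fun k => ?_) ?_
    · exact ((hF _).integrable_indicator measurableSet_Iic).aestronglyMeasurable
    · exact ((hF _).integrable_indicator measurableSet_Iic).norm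
    · refine Eventually.of_forall fun x => norm_indicator_le_of_subset (Iic_subset_Iic.2 ?_) F x
      intro i
      refine (hst k i).trans (add_le_add_right ?_ _)
      rw [div_le_one (by positivity)]
      simp
    · refine Eventually.of_forall fun x => tendsto_const_nhds.congr' ?_
      by_cases hx : x ≤ t
      · refine Eventually.of_forall fun k => ?_
        simp only [indicator_of_mem (mem_Iic.2 hx),
          indicator_of_mem (mem_Iic.2 (hx.trans (hts k)))]
      · obtain ⟨i, hi⟩ : ∃ i, t i < x i := by simpa [Pi.le_def] using hx
        have hev : ∀ᶠ k : ℕ in atTop, 1 / ((k : ℝ) + 1) < x i - t i :=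
          tendsto_one_div_add_atTop_nhds_zero_nat.eventually_lt_const (sub_pos.2 hi)
        filter_upwards [hev] with k hk
        rw [indicator_of_notMem (by simpa using hx), indicator_of_notMem]
        intro hxs
        have h1 : x i ≤ s k i := hxs i
        linarith [hst k i]
  simp only [hs0] at hlim
  exact tendsto_nhds_unique hlim tendsto_const_nhds |>.symm ▸ rfl

theorem mLapPartial_ofReal (n : ℕ) (f : (Fin n → ℝ) → ℂ) (l : Fin n → ℝ) (t : Fin n → ℝ) :
    mLapPartial n f (fun i => (l i : ℂ)) t = boxIntegral (fun s => expWeight l s • f s) t := by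
  have hbox : Set.pi univ (fun i => Ioc 0 (t i)) = Iic t ∩ orthant n := by
    ext s
    simp [orthant, Pi.le_def, forall_and, and_comm]
  rw [mLapPartial, boxIntegral, Measure.restrict_restrict measurableSet_Iic, hbox]
  simp [expWeight]

/-- If `F` has bounded primitive and its Laplace integrals at all points `(N * (p + 1) + i, p + 1)`
vanish, then `F` vanishes almost everywhere on the open quadrant. -/
theorem ae_eq_zero_of_tendsto_cone {N : ℕ} (hN : 0 < N) {F : (Fin 2 → ℝ) → ℂ}
    (hm : AEStronglyMeasurable F (volume.restrict (orthant 2)))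
    (hF : ∀ T, IntegrableOn F (Iic T) (volume.restrict (orthant 2)))
    {C : ℝ} (hC : ∀ t ∈ orthant 2, ‖boxIntegral F t‖ ≤ C)
    (h0 : ∀ i p : ℕ, Tendsto (boxIntegral fun s =>
      expWeight (![(N * p + i : ℝ), p] + ![(N : ℝ), 1]) s • F s) atTop (nhds 0)) :
    F =ᵐ[volume.restrict (orthant 2)] 0 := by
  have hN' : (0 : ℝ) < N := Nat.cast_pos.2 hN
  have hw : ∀ i, 0 < (![(N : ℝ), 1] : Fin 2 → ℝ) i := by simp [Fin.forall_fin_two, hN]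
  have hz (i p : ℕ) : ∀ j, 0 < (![(N * p + i : ℝ), p] + ![(N : ℝ), 1]) j := by
    simp only [Fin.forall_fin_two, Pi.add_apply, Matrix.cons_val_zero, Matrix.cons_val_one]
    constructor <;> positivity
  have hbox : boxIntegral F =ᵐ[volume.restrict (orthant 2)] 0 := by
    have hint : IntegrableOn (fun t => expWeight ![(N : ℝ), 1] t • boxIntegral F t) (orthant 2) :=
      Integrable.smul_bdd (integrableOn_expWeight_orthant hw) C
        (aestronglyMeasurable_boxIntegral hm)
        ((ae_restrict_mem (isOpen_orthant 2).measurableSet).mono hC)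
    filter_upwards [ae_eq_zero_of_forall_integral_cone N hint fun i p => by
      simpa only [expWeight_add, mul_smul] using
        integral_expWeight_smul_boxIntegral_eq_zero (hz i p) hm hF hC (h0 i p)] with t ht
    exact (smul_eq_zero.1 ht).resolve_left (expWeight_pos _ t).ne'
  have hvanish (k : ℕ) : ∀ᵐ t ∂(volume.restrict (orthant 2)),
      (Iic fun _ => (k + 1 : ℝ)).indicator (fun s => expWeight ![(N : ℝ), 1] s • F s) t = 0 := by
    set T : Fin 2 → ℝ := fun _ => (k + 1 : ℝ)
    have hint : IntegrableOn (fun s => expWeight ![(N : ℝ), 1] s • F s) (Iic T)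
        (volume.restrict (orthant 2)) := by
      refine Integrable.bdd_smul (hF T) 1 (continuous_expWeight _).aestronglyMeasurable ?_
      filter_upwards [ae_restrict_of_ae (ae_restrict_mem (isOpen_orthant 2).measurableSet)]
        with t ht
      rw [Real.norm_of_nonneg (expWeight_pos _ t).le]
      exact expWeight_le_one (fun i => (hw i).le) ht
    refine ae_eq_zero_of_forall_integral_cone N (hint.integrable_indicator measurableSet_Iic)
      fun i p => ?_
    have hA := setIntegral_Iic_expWeight_smul (hz i p) (hF T)
    rw [setIntegral_congr_fun (g := 0) (isOpen_orthant 2).measurableSet] at hA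
    · simp only [Pi.zero_apply, integral_zero, smul_zero, expWeight_add, mul_smul] at hA
      rw [← hA, ← integral_indicator measurableSet_Iic]
      congr 1 with s
      simp only [indicator]
      split_ifs <;> simp
    · intro t ht
      have : t ⊓ T ∈ orthant 2 :=
        mem_orthant.2 fun i => lt_inf_iff.2 ⟨mem_orthant.1 ht i, by positivity⟩
      have h := boxIntegral_eq_zero_of_ae hF hbox this
      rw [boxIntegral] at h
      simp only [h, smul_zero, Pi.zero_apply]
  filter_upwards [ae_all_iff.2 hvanish] with t ht
  obtain ⟨k, hk⟩ := exists_nat_ge (max (t 0) (t 1))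
  have hmem : t ∈ Iic (fun _ : Fin 2 => (k + 1 : ℝ)) := by
    refine mem_Iic.2 (Pi.le_def.2 (Fin.forall_fin_two.2 ⟨?_, ?_⟩))
    · linarith [le_max_left (t 0) (t 1)]
    · linarith [le_max_right (t 0) (t 1)]
  have h := ht k
  rw [indicator_of_mem hmem] at h
  exact (smul_eq_zero.1 h).resolve_left (expWeight_pos _ t).ne'

theorem exists_nat_arg_le {θ : ℝ} (hθ : θ ∈ Ioo 0 (Real.pi / 2)) :
    ∃ N : ℕ, 0 < N ∧ ∀ x y : ℝ, 0 < y → N * y ≤ x → Complex.arg (x + y * Complex.I) ≤ θ := by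
  have htan : 0 < Real.tan θ := Real.tan_pos_of_pos_of_lt_pi_div_two hθ.1 hθ.2
  obtain ⟨N, hN⟩ := exists_nat_gt (Real.tan θ)⁻¹
  have hN0 : (0 : ℝ) < N := (inv_pos.2 htan).trans hN
  refine ⟨N, Nat.cast_pos.1 hN0, fun x y hy hxy => ?_⟩
  have hx : 0 < x := (mul_pos hN0 hy).trans_le hxy
  have harg : |Complex.arg (x + y * Complex.I)| < Real.pi / 2 :=
    Complex.abs_arg_lt_pi_div_two_iff.2 (Or.inl (by simpa using hx))
  by_contra! hlt
  have hmono := Real.tan_lt_tan_of_lt_of_lt_pi_div_two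
    (by linarith [hθ.1, Real.pi_pos]) (abs_lt.1 harg).2 hlt
  rw [Complex.tan_arg] at hmono
  simp only [Complex.add_im, Complex.ofReal_im, Complex.mul_im, Complex.ofReal_re, Complex.I_im,
    Complex.I_re, Complex.add_re, Complex.mul_re, mul_one, mul_zero, zero_add, add_zero,
    sub_zero] at hmono
  rw [lt_div_iff₀ hx] at hmono
  have h1 : 1 < N * Real.tan θ := by rwa [inv_lt_iff_one_lt_mul₀ htan] at hN
  nlinarith [mul_le_mul_of_nonneg_right hxy htan.le]

theorem stmt13 (θ : ℝ) (hθ : θ ∈ Set.Ioo 0 (Real.pi / 2)) :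
    IsMUniquenessFamily 2
      (fun (q : {p : ℕ × ℕ //
          Complex.arg ((((p.1 : ℝ) + 1 : ℝ) : ℂ) + (((p.2 : ℝ) + 1 : ℝ) : ℂ) * Complex.I) ≤ θ}) =>
        ![((((q : ℕ × ℕ).1 : ℝ) + 1 : ℝ) : ℂ), ((((q : ℕ × ℕ).2 : ℝ) + 1 : ℝ) : ℂ)]) := by
  rintro f hf ⟨ω, -, hω, hωlam⟩ hzero
  obtain ⟨N, hN, harg⟩ := exists_nat_arg_le hθ
  have hcast (i p : ℕ) : ((N * p + i + N - 1 : ℕ) : ℝ) + 1 = N * p + i + N := by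
    rw [← Nat.cast_add_one, Nat.sub_add_cancel (by omega)]
    push_cast
    ring
  have hlattice (i p : ℕ) : Complex.arg ((((N * p + i + N - 1 : ℕ) : ℝ) + 1 : ℝ) +
      (((p : ℝ) + 1 : ℝ) : ℂ) * Complex.I) ≤ θ := by
    refine harg _ _ (by positivity) ?_
    rw [hcast]
    linarith [(Nat.cast_nonneg i : (0 : ℝ) ≤ i)]
  have hpoint (i p : ℕ) :
      ![((((N * p + i + N - 1 : ℕ) : ℝ) + 1 : ℝ) : ℂ), (((p : ℝ) + 1 : ℝ) : ℂ)] =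
        fun j => (((![(N * p + i : ℝ), p] + ![(N : ℝ), 1]) j : ℝ) : ℂ) := by
    rw [hcast]
    ext j
    fin_cases j <;> simp
  have hsub : orthant 2 ⊆ {t | ∀ i, 0 ≤ t i} := fun t ht i => (mem_orthant.1 ht i).le
  have hmeas : AEStronglyMeasurable f (volume.restrict (orthant 2)) :=
    hf.aestronglyMeasurable.mono_set hsub
  have hint (z T : Fin 2 → ℝ) : IntegrableOn (fun s => expWeight z s • f s) (Iic T)
      (volume.restrict (orthant 2)) := by
    have hIcc : IntegrableOn (fun s => expWeight z s • f s) (Icc 0 T) :=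
      (hf.integrableOn_compact_subset (fun s hs => hs.1) isCompact_Icc).continuousOn_smul
        (continuous_expWeight z).continuousOn isCompact_Icc
    rw [IntegrableOn, Measure.restrict_restrict measurableSet_Iic]
    exact hIcc.mono_set fun s hs => ⟨hsub hs.2, hs.1⟩
  have hbdd : (fun j => ((![(N : ℝ), 1] j : ℝ) : ℂ)) ∈ mOmegaB 2 f := by
    have h : _ ∈ mOmegaB 2 f := (hω fun j => hωlam ⟨(_, _), hlattice 0 0⟩ j).1
    simp only [hpoint] at h
    convert h using 4 with j
    fin_cases j <;> simp
  rw [mOmegaB, mem_ofPred_eq] at hbdd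
  obtain ⟨C, hC⟩ := hbdd.exists_norm_le
  have hae := ae_eq_zero_of_tendsto_cone hN (F := fun s => expWeight ![(N : ℝ), 1] s • f s)
    ((continuous_expWeight _).aestronglyMeasurable.smul hmeas) (hint _) (C := C)
    (fun t ht => by
      rw [← mLapPartial_ofReal]
      exact hC _ ⟨t, hsub ht, rfl⟩)
    (fun i p => by
      have h := hzero ⟨(_, _), hlattice i (p + 1)⟩
      simp only [hpoint, HasMLaplace, funext (mLapPartial_ofReal 2 f _)] at h
      have hz : ![(N * p + i : ℝ), p] + ![(N : ℝ), 1] = ![(N * (p + 1 : ℕ) + i : ℝ), (p + 1 : ℕ)] := by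
        ext j
        fin_cases j <;> simp
        ring
      simpa only [hz, ← mul_smul, ← expWeight_add] using h)
  have hS : orthant 2 =ᵐ[volume] Ici 0 := Measure.univ_pi_Ioi_ae_eq_Ici
  rw [Measure.restrict_congr_set hS, EventuallyEq, ae_restrict_iff' measurableSet_Ici] at hae
  filter_upwards [hae] with t ht htpos
  exact (smul_eq_zero.1 (ht htpos)).resolve_left (expWeight_pos _ t).ne'

end
end
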